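/- Let g : [0,∞) → [0,∞) be nondecreasing and let X_1,…,X_k be independent random vectors in R^n with densities f_1,…,f_k. Let X_1*,…,X_k* be independent with densities f_1*,…,f_k*. Then E[g(‖X_1 + ⋯ + X_k‖)] ≥ E[g(‖X_1* + ⋯ + X_k*‖)]. -/

import Mathlib

open MeasureTheory Set Filter ENNReal

noncomputable section

/-- The spherically symmetric (decreasing) rearrangement of a set `A ⊆ ℝⁿ`:
the centered open ball with the same Lebesgue measure as `A`
(empty if `A` is null, all of `ℝⁿ` if `A` has infinite measure). -/
def ballRearrange (n : ℕ) (A : Set (EuclideanSpace ℝ (Fin n))) :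
    Set (EuclideanSpace ℝ (Fin n)) :=
  {x | volume (Metric.ball (0 : EuclideanSpace ℝ (Fin n)) ‖x‖) < volume A}

/-- The spherically symmetric decreasing rearrangement of a function:
`f*(y) = ∫₀^∞ 1{y ∈ {x : f x > t}*} dt`. -/
def symmRearr (n : ℕ) (f : EuclideanSpace ℝ (Fin n) → ℝ≥0∞) :
    EuclideanSpace ℝ (Fin n) → ℝ≥0∞ :=
  fun y => ∫⁻ t in Ioi (0 : ℝ), (ballRearrange n {x | ENNReal.ofReal t < f x}).indicator 1 y

/-- `f` is a probability density on `ℝⁿ`. -/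
def IsDensity (n : ℕ) (f : EuclideanSpace ℝ (Fin n) → ℝ≥0∞) : Prop :=
  Measurable f ∧ ∫⁻ x, f x = 1

/-- Integral of the positive part of `-f log f`. -/
def entPos (n : ℕ) (f : EuclideanSpace ℝ (Fin n) → ℝ≥0∞) : ℝ≥0∞ :=
  ∫⁻ x, ENNReal.ofReal (-((f x).toReal * Real.log (f x).toReal))

/-- Integral of the negative part of `-f log f`. -/
def entNeg (n : ℕ) (f : EuclideanSpace ℝ (Fin n) → ℝ≥0∞) : ℝ≥0∞ :=
  ∫⁻ x, ENNReal.ofReal ((f x).toReal * Real.log (f x).toReal)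

/-- The Shannon differential entropy `h(f) = -∫ f log f` is well defined. -/
def EntDefined (n : ℕ) (f : EuclideanSpace ℝ (Fin n) → ℝ≥0∞) : Prop :=
  entPos n f ≠ ⊤ ∨ entNeg n f ≠ ⊤

/-- The Shannon differential entropy as an extended real number. -/
def entropy (n : ℕ) (f : EuclideanSpace ℝ (Fin n) → ℝ≥0∞) : EReal :=
  (entPos n f : EReal) - (entNeg n f : EReal)

/-- The Rényi entropy of order `p ∈ (0,1) ∪ (1,∞)`:
`h_p(f) = (1/(1-p)) log ∫ f^p`. -/
def renyi (n : ℕ) (f : EuclideanSpace ℝ (Fin n) → ℝ≥0∞) (p : ℝ) : EReal :=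
  (((1 - p)⁻¹ : ℝ) : EReal) * ENNReal.log (∫⁻ x, f x ^ p)

/-- Convolution of two `ℝ≥0∞`-valued functions on `ℝⁿ`. -/
def conv2 (n : ℕ) (f g : EuclideanSpace ℝ (Fin n) → ℝ≥0∞) :
    EuclideanSpace ℝ (Fin n) → ℝ≥0∞ :=
  fun x => ∫⁻ y, f y * g (x - y)

/-- Iterated convolution of a (nonempty) list of functions. -/
def convList (n : ℕ) : List (EuclideanSpace ℝ (Fin n) → ℝ≥0∞) →
    (EuclideanSpace ℝ (Fin n) → ℝ≥0∞)
  | [] => fun _ => 0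
  | [f] => f
  | f :: g :: rest => conv2 n f (convList n (g :: rest))

/-- `f ≺ g`: `f` is majorized by `g`. -/
def Majorizes (n : ℕ) (f g : EuclideanSpace ℝ (Fin n) → ℝ≥0∞) : Prop :=
  ∀ r : ℝ, 0 < r →
    ∫⁻ x in Metric.ball (0 : EuclideanSpace ℝ (Fin n)) r, symmRearr n f x ≤
      ∫⁻ x in Metric.ball (0 : EuclideanSpace ℝ (Fin n)) r, symmRearr n g x

set_option linter.unusedSectionVars false

lemma setLIntegral_Ioi_indicator_ofReal_lt (a : ℝ≥0∞) {τ : ℝ} (hτ : 0 ≤ τ) :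
    ∫⁻ t in Ioi τ, {t : ℝ | ENNReal.ofReal t < a}.indicator 1 t = a - ENNReal.ofReal τ := by
  have hm : MeasurableSet {t : ℝ | ENNReal.ofReal t < a} :=
    measurableSet_lt ENNReal.measurable_ofReal measurable_const
  rw [lintegral_indicator_one hm, Measure.restrict_apply hm]
  induction a with
  | top => simp [ENNReal.ofReal_lt_top]
  | coe a =>
    have : {t : ℝ | ENNReal.ofReal t < a} ∩ Ioi τ = Ioo τ a := by
      ext t
      simp only [mem_inter_iff, mem_ofPred_eq, mem_Ioi, mem_Ioo]
      rw [and_comm]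
      refine and_congr_right fun h => ?_
      rw [← ENNReal.ofReal_coe_nnreal, ENNReal.ofReal_lt_ofReal_iff_of_nonneg (hτ.trans h.le)]
    rw [this, Real.volume_Ioo, ENNReal.ofReal_sub _ hτ, ENNReal.ofReal_coe_nnreal]

/-- The pairs in `A × B` with sum in `C`. -/
def sumPairs {G : Type*} [Add G] (A B C : Set G) : Set (G × G) :=
  {p | p.1 ∈ A ∧ p.2 ∈ B ∧ p.1 + p.2 ∈ C}

section Group

variable {G : Type*} [AddCommGroup G] [MeasurableSpace G] [MeasurableAdd₂ G] [MeasurableNeg G]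

lemma measurableSet_sumPairs {A B C : Set G} (hA : MeasurableSet A) (hB : MeasurableSet B)
    (hC : MeasurableSet C) : MeasurableSet (sumPairs A B C) :=
  (measurable_fst hA).inter ((measurable_snd hB).inter ((measurable_fst.add measurable_snd) hC))

lemma sumPairs_mono {A B C A' B' C' : Set G} (hA : A ⊆ A') (hB : B ⊆ B') (hC : C ⊆ C') :
    sumPairs A B C ⊆ sumPairs A' B' C' :=
  fun _ h => ⟨hA h.1, hB h.2.1, hC h.2.2⟩

variable (μ : Measure G) [SFinite μ] [μ.IsAddLeftInvariant]

lemma measure_prod_eq_lintegral_antidiagonal {S : Set (G × G)} (hS : MeasurableSet S) :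
    (μ.prod μ) S = ∫⁻ z, μ {x | (x, z - x) ∈ S} ∂μ := by
  have hS' : MeasurableSet {p : G × G | (p.2, p.1 - p.2) ∈ S} :=
    (measurable_snd.prodMk (measurable_fst.sub measurable_snd)) hS
  have h1 : ∀ x, μ (Prod.mk x ⁻¹' S) = μ (Prod.mk x ⁻¹' {p : G × G | (p.1, p.2 - p.1) ∈ S}) := by
    intro x
    rw [← measure_preimage_add μ (-x) (Prod.mk x ⁻¹' S)]
    congr 1
    ext y
    simp [sub_eq_add_neg, add_comm]
  have hS'' : MeasurableSet {p : G × G | (p.1, p.2 - p.1) ∈ S} :=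
    (measurable_fst.prodMk (measurable_snd.sub measurable_fst)) hS
  rw [Measure.prod_apply hS]
  simp_rw [h1]
  rw [← Measure.prod_apply hS'', Measure.prod_apply_symm hS'']
  rfl

variable [μ.IsNegInvariant]

lemma measure_sub_left_preimage (z : G) (B : Set G) : μ {x | z - x ∈ B} = μ B := by
  rw [← Measure.measure_neg μ B, ← measure_preimage_add μ (-z) (-B)]
  congr 1
  ext y
  simp [sub_eq_add_neg, add_comm]

lemma measure_sumPairs_eq {A B C : Set G} (hA : MeasurableSet A) (hB : MeasurableSet B)
    (hC : MeasurableSet C) :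
    (μ.prod μ) (sumPairs A B C) = ∫⁻ z in C, μ {x | x ∈ A ∧ z - x ∈ B} ∂μ := by
  rw [measure_prod_eq_lintegral_antidiagonal μ (measurableSet_sumPairs hA hB hC),
    ← lintegral_indicator hC]
  refine lintegral_congr fun z => ?_
  by_cases hz : z ∈ C <;> simp [sumPairs, hz]

lemma measure_sumPairs_le₁₂ (A B C : Set G) :
    (μ.prod μ) (sumPairs A B C) ≤ μ A * μ B := by
  rw [← Measure.prod_prod]
  exact measure_mono fun p hp => ⟨hp.1, hp.2.1⟩

lemma measure_sumPairs_le₁₃ {A B C : Set G} (hA : MeasurableSet A) (hB : MeasurableSet B)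
    (hC : MeasurableSet C) : (μ.prod μ) (sumPairs A B C) ≤ μ A * μ C := by
  rw [measure_sumPairs_eq μ hA hB hC]
  calc _ ≤ ∫⁻ _ in C, μ A ∂μ := lintegral_mono fun z => measure_mono fun x hx => hx.1
    _ = _ := by simp

lemma measure_sumPairs_le₂₃ {A B C : Set G} (hA : MeasurableSet A) (hB : MeasurableSet B)
    (hC : MeasurableSet C) : (μ.prod μ) (sumPairs A B C) ≤ μ B * μ C := by
  rw [measure_sumPairs_eq μ hA hB hC]
  calc _ ≤ ∫⁻ _ in C, μ B ∂μ := lintegral_mono fun z =>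
        (measure_mono fun x hx => hx.2).trans (measure_sub_left_preimage μ z B).le
    _ = _ := by simp

lemma measure_sumPairs_eq₁₂ {A B C : Set G} (h : ∀ x ∈ A, ∀ y ∈ B, x + y ∈ C) :
    (μ.prod μ) (sumPairs A B C) = μ A * μ B := by
  rw [← Measure.prod_prod]
  congr 1
  ext p
  exact ⟨fun hp => ⟨hp.1, hp.2.1⟩, fun hp => ⟨hp.1, hp.2, h _ hp.1 _ hp.2⟩⟩

lemma measure_sumPairs_eq₁₃ {A B C : Set G} (hA : MeasurableSet A) (hB : MeasurableSet B)
    (hC : MeasurableSet C) (h : ∀ x ∈ A, ∀ z ∈ C, z - x ∈ B) :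
    (μ.prod μ) (sumPairs A B C) = μ A * μ C := by
  rw [measure_sumPairs_eq μ hA hB hC, setLIntegral_congr_fun hC (g := fun _ => μ A)]
  · simp
  · intro z hz
    exact congrArg μ (Set.ext fun x => ⟨fun hx => hx.1, fun hx => ⟨hx, h x hx z hz⟩⟩)

lemma measure_sumPairs_eq₂₃ {A B C : Set G} (hA : MeasurableSet A) (hB : MeasurableSet B)
    (hC : MeasurableSet C) (h : ∀ y ∈ B, ∀ z ∈ C, z - y ∈ A) :
    (μ.prod μ) (sumPairs A B C) = μ B * μ C := by
  rw [measure_sumPairs_eq μ hA hB hC, setLIntegral_congr_fun hC (g := fun _ => μ B)]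
  · simp
  · intro z hz
    refine Eq.trans (congrArg μ (Set.ext fun x => ⟨fun hx => hx.2, fun hx => ⟨?_, hx⟩⟩))
      (measure_sub_left_preimage μ z B)
    simpa using h _ hx z hz

end Group

lemma exists_volume_inter_Iic_eq {A : Set ℝ} (hb : Bornology.IsBounded A) {t : ℝ≥0∞}
    (ht : t ≤ volume A) : ∃ α, volume (A ∩ Iic α) = t := by
  obtain ⟨R, hR⟩ := hb.subset_closedBall 0
  have hfin : ∀ α, volume (A ∩ Iic α) ≠ ⊤ := fun α =>
    measure_ne_top_of_subset (inter_subset_left.trans hR) measure_closedBall_lt_top.ne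
  have htf : t ≠ ⊤ := ne_top_of_le_ne_top
    (measure_ne_top_of_subset hR measure_closedBall_lt_top.ne) ht
  have hR' : ∀ x ∈ A, -R ≤ x ∧ x ≤ R := fun x hx => by
    have := hR hx
    rwa [mem_closedBall_zero_iff, Real.norm_eq_abs, abs_le] at this
  have hL : LipschitzWith 1 fun α => (volume (A ∩ Iic α)).toReal := by
    refine LipschitzWith.of_le_add fun α β => ?_
    have : volume (A ∩ Iic α) ≤ volume (A ∩ Iic β) + ENNReal.ofReal (dist α β) := by
      refine (measure_mono (t := (A ∩ Iic β) ∪ Ioc β α) fun x hx => ?_).trans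
        ((measure_union_le _ _).trans ?_)
      · rcases le_or_gt x β with h | h
        · exact Or.inl ⟨hx.1, h⟩
        · exact Or.inr ⟨h, hx.2⟩
      · rw [Real.volume_Ioc]
        gcongr
        exact le_abs_self _
    have := ENNReal.toReal_mono (by finiteness [hfin β]) this
    rwa [ENNReal.toReal_add (hfin β) ENNReal.ofReal_ne_top,
      ENNReal.toReal_ofReal dist_nonneg] at this
  have hlo : (volume (A ∩ Iic (-R - 1))).toReal = 0 := by
    have : A ∩ Iic (-R - 1) = ∅ := by
      ext x
      simp only [mem_inter_iff, mem_Iic, mem_empty_iff_false, iff_false, not_and]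
      intro hx
      linarith [hR' x hx]
    simp [this]
  have hhi : A ∩ Iic R = A := inter_eq_left.2 fun x hx => (hR' x hx).2
  obtain ⟨α, hα⟩ := mem_range_of_exists_le_of_exists_ge hL.continuous (c := t.toReal)
    ⟨-R - 1, by rw [hlo]; positivity⟩ ⟨R, by
      simp only [hhi]
      exact ENNReal.toReal_mono (hhi ▸ hfin R) ht⟩
  exact ⟨α, (ENNReal.toReal_eq_toReal_iff' (hfin α) htf).1 hα⟩

lemma volume_sumPairs_real_le {A B C : Set ℝ} (hA : MeasurableSet A) (hB : MeasurableSet B)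
    (hC : MeasurableSet C) (hA' : Bornology.IsBounded A) (hB' : Bornology.IsBounded B) {t : ℝ≥0∞}
    (hta : t ≤ volume A) (htb : t ≤ volume B) :
    volume (sumPairs A B C) ≤ t * volume C + (volume A - t) * (volume B - t) := by
  obtain ⟨α, hα⟩ := exists_volume_inter_Iic_eq hA' hta
  obtain ⟨β, hβ⟩ := exists_volume_inter_Iic_eq hB' (tsub_le_self : volume B - t ≤ volume B)
  have htf : t ≠ ⊤ := ne_top_of_le_ne_top hB'.measure_lt_top.ne htb
  have hα' : volume (A ∩ Ioi α) = volume A - t := by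
    rw [← measure_inter_add_sdiff A (measurableSet_Iic (a := α)), hα,
      ENNReal.add_sub_cancel_left htf]
    congr 1
    ext x; simp
  have hβ' : volume (B ∩ Ioi β) = t := by
    have h := measure_inter_add_sdiff (μ := volume) B (measurableSet_Iic (a := β))
    rw [hβ] at h
    have h2 : volume B - t + t = volume B := tsub_add_cancel_of_le htb
    have h3 : volume (B \ Iic β) = t := by
      have hf : volume B - t ≠ ⊤ := ne_top_of_le_ne_top hB'.measure_lt_top.ne tsub_le_self
      exact (ENNReal.add_right_inj hf).1 (h.trans h2.symm)
    rw [← h3]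
    congr 1
    ext x; simp
  have hV : MeasurableSet (sumPairs A B C ∩ {p | p.1 ≤ α ∨ β < p.2}) :=
    (measurableSet_sumPairs hA hB hC).inter
      ((measurableSet_le measurable_fst measurable_const).union
        (measurableSet_lt measurable_const measurable_snd))
  have hsub : sumPairs A B C ⊆ sumPairs A B C ∩ {p | p.1 ≤ α ∨ β < p.2} ∪
      (A ∩ Ioi α) ×ˢ (B ∩ Iic β) := by
    intro p hp
    by_cases h : p.1 ≤ α ∨ β < p.2
    · exact Or.inl ⟨hp, h⟩
    · push Not at h
      exact Or.inr ⟨⟨hp.1, h.1⟩, ⟨hp.2.1, h.2⟩⟩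
  refine (measure_mono hsub).trans ((measure_union_le _ _).trans ?_)
  gcongr
  · rw [Measure.volume_eq_prod, measure_prod_eq_lintegral_antidiagonal _ hV]
    calc _ ≤ ∫⁻ z, C.indicator (fun _ => t) z := lintegral_mono fun z => ?_
      _ = _ := by rw [lintegral_indicator hC]; simp
    by_cases hz : z ∈ C
    · rw [indicator_of_mem hz]
      rcases le_total (z - β) α with h | h
      · rw [← hα]
        refine measure_mono fun x hx => ⟨hx.1.1, ?_⟩
        rcases hx.2 with h1 | h1
        · exact h1
        · simp only [mem_Iic]
          simp only at h1
          linarith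
      · rw [← hβ', ← measure_sub_left_preimage volume z (B ∩ Ioi β)]
        have : {x | (x, z - x) ∈ sumPairs A B C ∩ {p | p.1 ≤ α ∨ β < p.2}} ⊆
            {x | z - x ∈ B ∩ Ioi β} ∪ {z - β} := by
          intro x hx
          by_cases hxz : x = z - β
          · exact Or.inr hxz
          refine Or.inl ⟨hx.1.2.1, ?_⟩
          rcases hx.2 with h1 | h1
          · have : x < z - β := lt_of_le_of_ne (le_trans h1 h) hxz
            simp only [mem_Ioi]
            linarith
          · exact h1
        refine (measure_mono (μ := volume) this).trans ((measure_union_le _ _).trans ?_)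
        rw [Real.volume_singleton, add_zero]
    · rw [indicator_of_notMem hz]
      have : {x | (x, z - x) ∈ sumPairs A B C ∩ {p | p.1 ≤ α ∨ β < p.2}} = ∅ := by
        ext x
        simp [sumPairs, hz]
      rw [this, measure_empty]
  · rw [Measure.volume_eq_prod, Measure.prod_prod, hα', hβ]

/-- The open interval of length `m` centered at `0`. -/
def centeredInterval (m : ℝ≥0∞) : Set ℝ := {s | ENNReal.ofReal (2 * |s|) < m}

lemma measurableSet_centeredInterval (m : ℝ≥0∞) : MeasurableSet (centeredInterval m) :=
  measurableSet_lt (by fun_prop) measurable_const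

lemma centeredInterval_mono {m m' : ℝ≥0∞} (h : m ≤ m') :
    centeredInterval m ⊆ centeredInterval m' :=
  fun _ ht => lt_of_lt_of_le ht h

lemma mem_centeredInterval_ofReal {a s : ℝ} :
    s ∈ centeredInterval (ENNReal.ofReal a) ↔ 2 * |s| < a := by
  rw [centeredInterval, mem_ofPred_eq, ENNReal.ofReal_lt_ofReal_iff']
  exact ⟨fun h => h.1, fun h => ⟨h, lt_of_le_of_lt (by positivity) h⟩⟩

lemma centeredInterval_ofReal (a : ℝ) :
    centeredInterval (ENNReal.ofReal a) = Ioo (-(a / 2)) (a / 2) := by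
  ext s
  rw [mem_centeredInterval_ofReal, mem_Ioo, ← abs_lt]
  constructor <;> intro h <;> linarith

lemma volume_centeredInterval (m : ℝ≥0∞) : volume (centeredInterval m) = m := by
  rcases eq_or_ne m ⊤ with rfl | hm
  · have : centeredInterval ⊤ = univ := by
      ext s
      simp only [centeredInterval, ENNReal.ofReal_lt_top, ofPred_true, mem_univ]
    simp [this]
  · rw [← ENNReal.ofReal_toReal hm, centeredInterval_ofReal, Real.volume_Ioo]
    congr 1
    ring

lemma le_volume_sumPairs_Ioo {a b c t : ℝ} (h : c = a + b - 2 * t) (h0 : 0 ≤ t)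
    (hta : t ≤ a) (htb : t ≤ b) :
    ENNReal.ofReal t * ENNReal.ofReal c + ENNReal.ofReal (a - t) * ENNReal.ofReal (b - t) ≤
      volume (sumPairs (Ioo (-(a / 2)) (a / 2)) (Ioo (-(b / 2)) (b / 2))
        (Ioo (-(c / 2)) (c / 2))) := by
  set S := sumPairs (Ioo (-(a / 2)) (a / 2)) (Ioo (-(b / 2)) (b / 2)) (Ioo (-(c / 2)) (c / 2))
  have hS : MeasurableSet S := measurableSet_sumPairs measurableSet_Ioo measurableSet_Ioo
    measurableSet_Ioo
  set V : Set (ℝ × ℝ) := {p | p.1 ≤ -(a / 2) + t ∨ b / 2 - t < p.2}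
  have hV : MeasurableSet V := (measurableSet_le measurable_fst measurable_const).union
        (measurableSet_lt measurable_const measurable_snd)
  rw [← measure_inter_add_sdiff S hV]
  gcongr
  · rw [Measure.volume_eq_prod, measure_prod_eq_lintegral_antidiagonal _ (hS.inter hV)]
    calc _ = ∫⁻ z in Ioo (-(c / 2)) (c / 2), ENNReal.ofReal t := by
          rw [lintegral_const, Measure.restrict_apply_univ, Real.volume_Ioo]
          congr 2
          ring
      _ = ∫⁻ z, (Ioo (-(c / 2)) (c / 2)).indicator (fun _ => ENNReal.ofReal t) z :=
          (lintegral_indicator measurableSet_Ioo _).symm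
      _ ≤ _ := lintegral_mono fun z => ?_
    by_cases hz : z ∈ Ioo (-(c / 2)) (c / 2)
    · rw [indicator_of_mem hz]
      have hl : ENNReal.ofReal t = volume (Ioo (max (-(a / 2)) (z - b / 2))
          (max (-(a / 2)) (z - b / 2) + t)) := by
        rw [Real.volume_Ioo]
        congr 1
        ring
      rw [hl]
      refine measure_mono fun x hx => ?_
      obtain ⟨hx1, hx2⟩ := hx
      obtain ⟨hx3, hx4⟩ := max_lt_iff.1 hx1
      obtain ⟨hz1, hz2⟩ := hz
      have hor : x < -(a / 2) + t ∨ x < z - b / 2 + t := by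
        rcases max_choice (-(a / 2)) (z - b / 2) with h | h <;> rw [h] at hx2
        · exact Or.inl hx2
        · exact Or.inr hx2
      refine ⟨⟨⟨hx3, ?_⟩, ⟨?_, ?_⟩, ?_, ?_⟩, ?_⟩ <;> simp only [V, mem_ofPred_eq]
      any_goals rcases hor with h1 | h1 <;> linarith
      rcases hor with h1 | h1
      · exact Or.inl h1.le
      · exact Or.inr (by linarith)
    · rw [indicator_of_notMem hz]
      positivity
  · calc _ = volume (Ioo (-(a / 2) + t) (a / 2) ×ˢ Ioo (-(b / 2)) (b / 2 - t)) := by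
          rw [Measure.volume_eq_prod, Measure.prod_prod, Real.volume_Ioo, Real.volume_Ioo]
          congr 2 <;> ring
      _ ≤ _ := measure_mono ?_
    rintro p ⟨⟨h1, h2⟩, h3, h4⟩
    refine ⟨⟨⟨?_, h2⟩, ⟨h3, ?_⟩, ?_, ?_⟩, ?_⟩
    any_goals linarith
    simp only [V, mem_ofPred_eq]
    push Not
    exact ⟨h1, h4.le⟩

/-- Riesz's rearrangement inequality for three subsets of the line. -/
lemma volume_sumPairs_real_le_centeredInterval {A B C : Set ℝ} (hA : MeasurableSet A)
    (hB : MeasurableSet B) (hC : MeasurableSet C) (hA' : Bornology.IsBounded A)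
    (hB' : Bornology.IsBounded B) (hC' : Bornology.IsBounded C) :
    volume (sumPairs A B C) ≤ volume (sumPairs (centeredInterval (volume A))
      (centeredInterval (volume B)) (centeredInterval (volume C))) := by
  obtain ⟨a, ha0, ha⟩ : ∃ a : ℝ, 0 ≤ a ∧ volume A = ENNReal.ofReal a :=
    ⟨_, ENNReal.toReal_nonneg, (ENNReal.ofReal_toReal hA'.measure_lt_top.ne).symm⟩
  obtain ⟨b, hb0, hb⟩ : ∃ a : ℝ, 0 ≤ a ∧ volume B = ENNReal.ofReal a :=
    ⟨_, ENNReal.toReal_nonneg, (ENNReal.ofReal_toReal hB'.measure_lt_top.ne).symm⟩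
  obtain ⟨c, hc0, hc⟩ : ∃ a : ℝ, 0 ≤ a ∧ volume C = ENNReal.ofReal a :=
    ⟨_, ENNReal.toReal_nonneg, (ENNReal.ofReal_toReal hC'.measure_lt_top.ne).symm⟩
  have hmA := measurableSet_centeredInterval (volume A)
  have hmB := measurableSet_centeredInterval (volume B)
  have hmC := measurableSet_centeredInterval (volume C)
  rcases le_or_gt (a + b) c with h | h
  · rw [Measure.volume_eq_prod, measure_sumPairs_eq₁₂ (A := centeredInterval _) volume,
      volume_centeredInterval, volume_centeredInterval]
    · exact measure_sumPairs_le₁₂ _ _ _ _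
    · rw [ha, hb, hc]
      intro x hx y hy
      rw [mem_centeredInterval_ofReal] at *
      linarith [abs_add_le x y]
  rcases le_or_gt (a + c) b with h' | h'
  · rw [Measure.volume_eq_prod, measure_sumPairs_eq₁₃ (A := centeredInterval _) volume hmA hmB hmC,
      volume_centeredInterval, volume_centeredInterval]
    · exact measure_sumPairs_le₁₃ _ hA hB hC
    · rw [ha, hb, hc]
      intro x hx y hy
      rw [mem_centeredInterval_ofReal] at *
      linarith [abs_sub y x]
  rcases le_or_gt (b + c) a with h'' | h''
  · rw [Measure.volume_eq_prod, measure_sumPairs_eq₂₃ (A := centeredInterval _) volume hmA hmB hmC,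
      volume_centeredInterval, volume_centeredInterval]
    · exact measure_sumPairs_le₂₃ _ hA hB hC
    · rw [ha, hb, hc]
      intro x hx y hy
      rw [mem_centeredInterval_ofReal] at *
      linarith [abs_sub y x]
  have ht0 : 0 ≤ (a + b - c) / 2 := by linarith
  refine (volume_sumPairs_real_le hA hB hC hA' hB' (t := ENNReal.ofReal ((a + b - c) / 2))
    ?_ ?_).trans ?_
  · rw [ha]
    gcongr
    linarith
  · rw [hb]
    gcongr
    linarith
  · rw [ha, hb, hc, centeredInterval_ofReal, centeredInterval_ofReal, centeredInterval_ofReal,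
      ← ENNReal.ofReal_sub _ ht0, ← ENNReal.ofReal_sub _ ht0]
    exact le_volume_sumPairs_Ioo (by ring) ht0 (by linarith) (by linarith)

section Steiner

variable {E : Type*} [NormedAddCommGroup E] [InnerProductSpace ℝ E] [FiniteDimensional ℝ E]
  [MeasureSpace E] [BorelSpace E] [(volume : Measure E).IsAddHaarMeasure]

/-- The parameters of the points of `A` on the line through `x` in the direction `z`. -/
def lineSection (z : E) (A : Set E) (x : E) : Set ℝ := {t | x + t • z ∈ A}

/-- The Steiner symmetrization of `A` in the direction of the unit vector `z`. -/
def steinerSymm (z : E) (A : Set E) : Set E :=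
  {x | inner ℝ x z ∈ centeredInterval (volume (lineSection z A x))}

lemma measurableSet_lineSection (z : E) {A : Set E} (hA : MeasurableSet A) (x : E) :
    MeasurableSet (lineSection z A x) :=
  (by fun_prop : Measurable fun t : ℝ => x + t • z) hA

lemma measurable_volume_lineSection (z : E) {A : Set E} (hA : MeasurableSet A) :
    Measurable fun x => volume (lineSection z A x) :=
  measurable_measure_prodMk_left (ν := (volume : Measure ℝ))
    ((by fun_prop : Measurable fun p : E × ℝ => p.1 + p.2 • z) hA)

lemma measurableSet_steinerSymm (z : E) {A : Set E} (hA : MeasurableSet A) :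
    MeasurableSet (steinerSymm z A) :=
  measurableSet_lt (by fun_prop) (measurable_volume_lineSection z hA)

lemma volume_lineSection_add_smul (z : E) (A : Set E) (x : E) (s : ℝ) :
    volume (lineSection z A (x + s • z)) = volume (lineSection z A x) := by
  rw [← measure_preimage_add volume s (lineSection z A x)]
  congr 1
  ext t
  simp [lineSection, add_smul, add_assoc]

lemma lineSection_steinerSymm {z : E} (hz : ‖z‖ = 1) (A : Set E) (x : E) :
    lineSection z (steinerSymm z A) x =
      (fun t => t + inner ℝ x z) ⁻¹' centeredInterval (volume (lineSection z A x)) := by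
  ext t
  simp only [lineSection, steinerSymm, mem_ofPred_eq, mem_preimage]
  rw [inner_add_left, real_inner_smul_left, real_inner_self_eq_norm_sq, hz, add_comm (inner ℝ x z)]
  have := volume_lineSection_add_smul z A x t
  simp only [lineSection] at this
  rw [this]
  simp

lemma volume_lineSection_steinerSymm {z : E} (hz : ‖z‖ = 1) (A : Set E) (x : E) :
    volume (lineSection z (steinerSymm z A) x) = volume (lineSection z A x) := by
  rw [lineSection_steinerSymm hz, measure_preimage_add_right, volume_centeredInterval]

/-- A fundamental domain for the translations by integer multiples of the unit vector `z`. -/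
def slab (z : E) : Set E := {x | inner ℝ x z ∈ Ico (0 : ℝ) 1}

lemma measurableSet_slab (z : E) : MeasurableSet (slab z) :=
  (by fun_prop : Measurable fun x : E => inner ℝ x z) measurableSet_Ico

lemma lintegral_eq_lintegral_slab {z : E} (hz : ‖z‖ = 1) {F : E → ℝ≥0∞} (hF : Measurable F) :
    ∫⁻ x, F x = ∫⁻ x in slab z, ∫⁻ t : ℝ, F (x + t • z) := by
  have hs := measurableSet_slab z
  have hind : Measurable ((slab z).indicator (1 : E → ℝ≥0∞)) := measurable_one.indicator hs
  calc ∫⁻ x, F x = ∫⁻ x, F x * ∫⁻ t : ℝ, (slab z).indicator 1 (x - t • z) := by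
        refine lintegral_congr fun x => ?_
        have : ∀ t : ℝ, (slab z).indicator (1 : E → ℝ≥0∞) (x - t • z) =
            (Ioc (inner ℝ x z - 1) (inner ℝ x z)).indicator 1 t := by
          intro t
          refine indicator_eq_indicator ?_ rfl
          simp only [slab, mem_ofPred_eq, inner_sub_left, real_inner_smul_left,
            real_inner_self_eq_norm_sq, hz, mem_Ico, mem_Ioc]
          constructor <;> rintro ⟨h1, h2⟩ <;> constructor <;> linarith
        simp_rw [this]
        rw [lintegral_indicator_one measurableSet_Ioc]
        simp
    _ = ∫⁻ x, ∫⁻ t : ℝ, F x * (slab z).indicator 1 (x - t • z) := by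
        refine lintegral_congr fun x => ?_
        exact (lintegral_const_mul _
          (hind.comp (by fun_prop : Measurable fun t : ℝ => x - t • z))).symm
    _ = ∫⁻ t : ℝ, ∫⁻ x, F x * (slab z).indicator 1 (x - t • z) := by
        refine lintegral_lintegral_swap (Measurable.aemeasurable ?_)
        exact (hF.comp measurable_fst).mul
          (hind.comp (by fun_prop : Measurable fun p : E × ℝ => p.1 - p.2 • z))
    _ = ∫⁻ t : ℝ, ∫⁻ x, F (x + t • z) * (slab z).indicator 1 x := by
        refine lintegral_congr fun t => ?_
        rw [← lintegral_add_right_eq_self _ (t • z)]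
        simp
    _ = ∫⁻ x, ∫⁻ t : ℝ, F (x + t • z) * (slab z).indicator 1 x := by
        refine lintegral_lintegral_swap (Measurable.aemeasurable ?_)
        exact (hF.comp (by fun_prop : Measurable fun p : ℝ × E => p.2 + p.1 • z)).mul
          (hind.comp measurable_snd)
    _ = _ := by
        rw [← lintegral_indicator hs]
        refine lintegral_congr fun x => ?_
        by_cases hx : x ∈ slab z <;> simp [hx]

lemma volume_eq_lintegral_slab {z : E} (hz : ‖z‖ = 1) {A : Set E} (hA : MeasurableSet A) :
    volume A = ∫⁻ x in slab z, volume (lineSection z A x) := by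
  rw [← lintegral_indicator_one hA, lintegral_eq_lintegral_slab hz (measurable_one.indicator hA)]
  refine lintegral_congr fun x => ?_
  rw [← lintegral_indicator_one (measurableSet_lineSection z hA x)]
  rfl

lemma volume_steinerSymm {z : E} (hz : ‖z‖ = 1) {A : Set E} (hA : MeasurableSet A) :
    volume (steinerSymm z A) = volume A := by
  rw [volume_eq_lintegral_slab hz hA, volume_eq_lintegral_slab hz (measurableSet_steinerSymm z hA)]
  simp_rw [volume_lineSection_steinerSymm hz]

lemma volume_sumPairs_eq_lintegral_slab {z : E} (hz : ‖z‖ = 1) {A B C : Set E}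
    (hA : MeasurableSet A) (hB : MeasurableSet B) (hC : MeasurableSet C) :
    volume (sumPairs A B C) = ∫⁻ x in slab z, ∫⁻ y in slab z,
      volume (sumPairs (lineSection z A x) (lineSection z B y) (lineSection z C (x + y))) := by
  have hS := measurableSet_sumPairs hA hB hC
  set F : E × E → ℝ≥0∞ := (sumPairs A B C).indicator 1 with hFdef
  have hF : Measurable F := measurable_one.indicator hS
  calc volume (sumPairs A B C) = ∫⁻ x, ∫⁻ y, F (x, y) := by
        rw [← lintegral_indicator_one hS, Measure.volume_eq_prod, lintegral_prod _ hF.aemeasurable]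
    _ = ∫⁻ x in slab z, ∫⁻ s : ℝ, ∫⁻ y, F (x + s • z, y) :=
        lintegral_eq_lintegral_slab hz hF.lintegral_prod_right'
    _ = ∫⁻ x in slab z, ∫⁻ s : ℝ, ∫⁻ y in slab z, ∫⁻ t : ℝ, F (x + s • z, y + t • z) := by
        refine lintegral_congr fun x => lintegral_congr fun s => ?_
        exact lintegral_eq_lintegral_slab hz (hF.comp measurable_prodMk_left)
    _ = ∫⁻ x in slab z, ∫⁻ y in slab z, ∫⁻ s : ℝ, ∫⁻ t : ℝ, F (x + s • z, y + t • z) := by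
        refine lintegral_congr fun x => lintegral_lintegral_swap (Measurable.aemeasurable ?_)
        exact (hF.comp (by fun_prop : Measurable fun p : (ℝ × E) × ℝ =>
          (x + p.1.1 • z, p.1.2 + p.2 • z))).lintegral_prod_right'
    _ = _ := by
        refine lintegral_congr fun x => lintegral_congr fun y => ?_
        have hm := measurableSet_sumPairs (measurableSet_lineSection z hA x)
          (measurableSet_lineSection z hB y) (measurableSet_lineSection z hC (x + y))
        rw [← lintegral_indicator_one hm, Measure.volume_eq_prod,
          lintegral_prod _ (measurable_one.indicator hm).aemeasurable]
        refine lintegral_congr fun s => lintegral_congr fun t => indicator_eq_indicator ?_ rfl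
        simp only [sumPairs, lineSection, mem_ofPred_eq, add_smul]
        rw [show x + y + (s • z + t • z) = x + s • z + (y + t • z) by abel]

lemma isBounded_lineSection {z : E} (hz : ‖z‖ = 1) {A : Set E} (hA : Bornology.IsBounded A)
    (x : E) : Bornology.IsBounded (lineSection z A x) := by
  obtain ⟨R, hR⟩ := hA.subset_closedBall x
  refine (Metric.isBounded_closedBall (x := (0 : ℝ)) (r := R)).subset fun t ht => ?_
  simpa [norm_smul, hz] using hR ht

lemma volume_sumPairs_le_steinerSymm {z : E} (hz : ‖z‖ = 1) {A B C : Set E}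
    (hA : MeasurableSet A) (hB : MeasurableSet B) (hC : MeasurableSet C)
    (hA' : Bornology.IsBounded A) (hB' : Bornology.IsBounded B) (hC' : Bornology.IsBounded C) :
    volume (sumPairs A B C) ≤
      volume (sumPairs (steinerSymm z A) (steinerSymm z B) (steinerSymm z C)) := by
  rw [volume_sumPairs_eq_lintegral_slab hz hA hB hC,
    volume_sumPairs_eq_lintegral_slab hz (measurableSet_steinerSymm z hA)
      (measurableSet_steinerSymm z hB) (measurableSet_steinerSymm z hC)]
  refine lintegral_mono fun x => lintegral_mono fun y => ?_
  refine (volume_sumPairs_real_le_centeredInterval (measurableSet_lineSection z hA x)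
    (measurableSet_lineSection z hB y) (measurableSet_lineSection z hC (x + y))
    (isBounded_lineSection hz hA' x) (isBounded_lineSection hz hB' y)
    (isBounded_lineSection hz hC' (x + y))).trans ?_
  rw [lineSection_steinerSymm hz, lineSection_steinerSymm hz, lineSection_steinerSymm hz,
    ← measure_preimage_add_right volume ((inner ℝ x z : ℝ), (inner ℝ y z : ℝ))]
  refine measure_mono fun p hp => ⟨hp.1, hp.2.1, ?_⟩
  have := hp.2.2
  simp only [Prod.fst_add, Prod.snd_add] at this
  rw [mem_preimage, inner_add_left]
  convert this using 1
  ring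

/-- `C` contains, with each point, all points of at most the same norm. -/
def IsCenteredBall (C : Set E) : Prop := ∀ ⦃x⦄, x ∈ C → ∀ ⦃y⦄, ‖y‖ ≤ ‖x‖ → y ∈ C

lemma steinerSymm_subset {z : E} (hz : ‖z‖ = 1) {A C : Set E} (hC : IsCenteredBall C)
    (hAC : A ⊆ C) : steinerSymm z A ⊆ C := by
  intro x hx
  by_contra hxC
  have hsub : lineSection z A x ⊆ (fun t => t + inner ℝ x z) ⁻¹'
      centeredInterval (ENNReal.ofReal (2 * |inner ℝ x z|)) := by
    intro t ht
    rw [mem_preimage, mem_centeredInterval_ofReal]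
    by_contra hlt
    refine hxC (hC (hAC ht) ?_)
    have h1 : (inner ℝ x z) ^ 2 ≤ (t + inner ℝ x z) ^ 2 := sq_le_sq.2 (by linarith)
    have h2 : ‖x + t • z‖ ^ 2 = ‖x‖ ^ 2 + 2 * t * inner ℝ x z + t ^ 2 := by
      rw [norm_add_sq_real, real_inner_smul_right, norm_smul, hz, mul_one, Real.norm_eq_abs, sq_abs]
      ring
    exact (sq_le_sq₀ (norm_nonneg _) (norm_nonneg _)).1 (by rw [h2]; linarith)
  have := measure_mono (μ := volume) hsub
  rw [measure_preimage_add_right, volume_centeredInterval] at this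
  exact absurd hx (not_lt.2 this)

lemma volume_steinerSymm_sdiff_add_le {z : E} (hz : ‖z‖ = 1) {A C : Set E} (hA : MeasurableSet A)
    (hCm : MeasurableSet C) (hA' : Bornology.IsBounded A) (hC : IsCenteredBall C) (c : ℝ) :
    volume (steinerSymm z A \ C) + volume {x | x ∈ C \ A ∧ x - c • z ∈ A \ C} ≤
      volume (A \ C) := by
  have hm1 := (measurableSet_steinerSymm z hA).diff hCm
  have hm2 : MeasurableSet {x | x ∈ C \ A ∧ x - c • z ∈ A \ C} :=
    (hCm.diff hA).inter ((by fun_prop : Measurable fun x : E => x - c • z) (hA.diff hCm))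
  rw [volume_eq_lintegral_slab hz hm1, volume_eq_lintegral_slab hz hm2,
    volume_eq_lintegral_slab hz (hA.diff hCm),
    ← lintegral_add_left (measurable_volume_lineSection z hm1)]
  refine lintegral_mono fun x => ?_
  set a := lineSection z A x
  set k := lineSection z C x
  have ha : MeasurableSet a := measurableSet_lineSection z hA x
  have hk : MeasurableSet k := measurableSet_lineSection z hCm x
  have hi : volume (a ∩ k) ≠ ⊤ :=
    measure_ne_top_of_subset inter_subset_left (isBounded_lineSection hz hA' x).measure_lt_top.ne
  have h1 : volume (lineSection z (steinerSymm z A \ C) x) ≤ volume a - volume k := by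
    have hsub : lineSection z (steinerSymm z A \ C) x ⊆ (fun t => t + inner ℝ x z) ⁻¹'
        (centeredInterval (volume a) \ centeredInterval (volume k)) := by
      intro t ht
      have h1 : t ∈ lineSection z (steinerSymm z A) x := ht.1
      have h2 : t ∉ lineSection z (steinerSymm z C) x :=
        fun h => ht.2 (steinerSymm_subset hz hC Subset.rfl h)
      rw [lineSection_steinerSymm hz] at h1 h2
      exact ⟨h1, h2⟩
    refine (measure_mono hsub).trans ?_
    rw [measure_preimage_add_right]
    rcases le_total (volume k) (volume a) with h | h
    · rw [measure_sdiff (centeredInterval_mono h)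
        (measurableSet_centeredInterval _).nullMeasurableSet, volume_centeredInterval,
        volume_centeredInterval]
      rw [volume_centeredInterval]
      exact ne_top_of_le_ne_top (isBounded_lineSection hz hA' x).measure_lt_top.ne h
    · rw [sdiff_eq_empty.2 (centeredInterval_mono h), measure_empty]
      positivity
  have h2 : volume (lineSection z {x | x ∈ C \ A ∧ x - c • z ∈ A \ C} x) ≤ volume (k \ a) :=
    measure_mono fun t ht => ht.1
  have h3 : volume (lineSection z {x | x ∈ C \ A ∧ x - c • z ∈ A \ C} x) ≤ volume (a \ k) := by
    rw [← measure_preimage_add_right volume (-c) (a \ k)]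
    refine measure_mono fun t ht => ?_
    have : x + (t + -c) • z = x + t • z - c • z := by
      rw [add_smul, neg_smul]
      abel
    have h4 := ht.2
    rw [← this] at h4
    exact h4
  change _ ≤ volume (a \ k)
  rw [← measure_inter_add_sdiff a hk, ← measure_inter_add_sdiff k ha, inter_comm k a,
    ENNReal.add_sub_add_eq_sub_left hi] at h1
  rcases le_total (volume (k \ a)) (volume (a \ k)) with h | h
  · calc _ ≤ volume (a \ k) - volume (k \ a) + volume (k \ a) := add_le_add h1 h2
      _ = _ := tsub_add_cancel_of_le h
  · rw [tsub_eq_zero_of_le h] at h1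
    rw [nonpos_iff_eq_zero.1 h1, zero_add]
    exact h3

lemma exists_lt_volume_inter_translate {A B : Set E} (hA : MeasurableSet A) (hB : MeasurableSet B)
    {R : ℝ} (hA' : A ⊆ Metric.closedBall 0 R) (hB' : B ⊆ Metric.closedBall 0 R) {q : ℝ≥0∞}
    (hq : q * volume (Metric.closedBall (0 : E) (2 * R)) < volume A * volume B) :
    ∃ w, q < volume {x | x ∈ B ∧ x - w ∈ A} := by
  by_contra! h
  refine absurd hq (not_lt.2 ?_)
  have hS : MeasurableSet (B ×ˢ (-A)) := hB.prod hA.neg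
  calc volume A * volume B = (volume.prod volume) (B ×ˢ (-A)) := by
        rw [Measure.prod_prod, Measure.measure_neg, mul_comm]
    _ = ∫⁻ w, volume {x | x ∈ B ∧ x - w ∈ A} := by
        rw [measure_prod_eq_lintegral_antidiagonal _ hS]
        simp
    _ ≤ ∫⁻ w, (Metric.closedBall (0 : E) (2 * R)).indicator (fun _ => q) w := by
        refine lintegral_mono fun w => ?_
        by_cases hw : w ∈ Metric.closedBall (0 : E) (2 * R)
        · rw [indicator_of_mem hw]
          exact h w
        · rw [indicator_of_notMem hw]
          have : {x | x ∈ B ∧ x - w ∈ A} = ∅ := by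
            ext x
            simp only [mem_ofPred_eq, mem_empty_iff_false, iff_false]
            rintro ⟨h1, h2⟩
            apply hw
            have h1 := hB' h1
            have h2 := hA' h2
            rw [mem_closedBall_zero_iff] at *
            calc ‖w‖ = ‖x - (x - w)‖ := by rw [sub_sub_self]
              _ ≤ _ := norm_sub_le _ _
              _ ≤ _ := by linarith
          rw [this, measure_empty]
    _ = _ := by
        rw [lintegral_indicator Metric.isClosed_closedBall.measurableSet]
        simp

lemma exists_volume_steinerSymm_sdiff_add_le {A C : Set E} (hA : MeasurableSet A)
    (hCm : MeasurableSet C) (hC : IsCenteredBall C) {R : ℝ} (hA' : A ⊆ Metric.closedBall 0 R)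
    (hC' : C ⊆ Metric.closedBall 0 R) (hAC : volume A = volume C) {d q : ℝ≥0∞}
    (hd : d ≤ volume (A \ C)) (hq : q * volume (Metric.closedBall (0 : E) (2 * R)) < d * d) :
    ∃ z : E, ‖z‖ = 1 ∧ volume (steinerSymm z A \ C) + q ≤ volume (A \ C) := by
  have hCf : volume C ≠ ⊤ := measure_ne_top_of_subset hC' measure_closedBall_lt_top.ne
  have hdiff : volume (C \ A) = volume (A \ C) := by
    have h1 := measure_inter_add_sdiff (μ := volume) A hCm
    have h2 := measure_inter_add_sdiff (μ := volume) C hA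
    rw [hAC, ← h2, inter_comm C A] at h1
    exact ((ENNReal.add_right_inj
      (measure_ne_top_of_subset inter_subset_right hCf)).1 h1).symm
  obtain ⟨w, hw⟩ := exists_lt_volume_inter_translate (hA.diff hCm) (hCm.diff hA)
    (sdiff_subset.trans hA') (sdiff_subset.trans hC')
    (hq.trans_le (mul_le_mul' hd (hd.trans hdiff.ge)))
  have hw0 : w ≠ 0 := by
    rintro rfl
    have : {x | x ∈ C \ A ∧ x - 0 ∈ A \ C} = ∅ := by
      ext x
      simp only [sub_zero, mem_ofPred_eq, mem_empty_iff_false, iff_false]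
      exact fun h => h.1.2 h.2.1
    rw [this, measure_empty] at hw
    exact not_lt_bot hw
  have hn : ‖w‖ ≠ 0 := norm_ne_zero_iff.2 hw0
  have hz : ‖(‖w‖⁻¹ • w)‖ = 1 := by rw [norm_smul, norm_inv, norm_norm, inv_mul_cancel₀ hn]
  refine ⟨‖w‖⁻¹ • w, hz, ?_⟩
  have := volume_steinerSymm_sdiff_add_le hz hA hCm (Metric.isBounded_closedBall.subset hA') hC ‖w‖
  rw [smul_smul, mul_inv_cancel₀ hn, one_smul] at this
  exact (add_le_add_right hw.le _).trans this

/-- Measurable sets of the same measure as the centered ball `C`, inside a fixed centered ball. -/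
structure IsCompetitor (R : ℝ) (C A : Set E) : Prop where
  measurableSet : MeasurableSet A
  subset : A ⊆ Metric.closedBall 0 R
  volume_eq : volume A = volume C

lemma isCenteredBall_closedBall (R : ℝ) : IsCenteredBall (Metric.closedBall (0 : E) R) := by
  intro x hx y hy
  rw [mem_closedBall_zero_iff] at *
  exact hy.trans hx

lemma IsCompetitor.steinerSymm {R : ℝ} {C A : Set E} (hA : IsCompetitor R C A) {z : E}
    (hz : ‖z‖ = 1) : IsCompetitor R C (steinerSymm z A) where
  measurableSet := measurableSet_steinerSymm z hA.measurableSet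
  subset := steinerSymm_subset hz (isCenteredBall_closedBall R) hA.subset
  volume_eq := (volume_steinerSymm hz hA.measurableSet).trans hA.volume_eq

lemma IsCompetitor.isBounded {R : ℝ} {C A : Set E} (hA : IsCompetitor R C A) :
    Bornology.IsBounded A :=
  Metric.isBounded_closedBall.subset hA.subset

lemma IsCompetitor.volume_steinerSymm_sdiff_le {R : ℝ} {C A : Set E} (hA : IsCompetitor R C A)
    (hCm : MeasurableSet C) (hC : IsCenteredBall C) {z : E} (hz : ‖z‖ = 1) :
    volume (_root_.steinerSymm z A \ C) ≤ volume (A \ C) :=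
  le_self_add.trans
    (volume_steinerSymm_sdiff_add_le hz hA.measurableSet hCm hA.isBounded hC 0)

lemma sInf_volume_sdiff_eq_zero {R : ℝ} {A₀ B₀ C₀ A₁ B₁ C₁ : Set E}
    (hA₁m : MeasurableSet A₁) (hB₁m : MeasurableSet B₁) (hC₁m : MeasurableSet C₁)
    (hA₁ : IsCenteredBall A₁) (hB₁ : IsCenteredBall B₁) (hC₁ : IsCenteredBall C₁)
    (hA₁R : A₁ ⊆ Metric.closedBall 0 R) (hB₁R : B₁ ⊆ Metric.closedBall 0 R)
    (hC₁R : C₁ ⊆ Metric.closedBall 0 R) (hA₀ : IsCompetitor R A₁ A₀)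
    (hB₀ : IsCompetitor R B₁ B₀) (hC₀ : IsCompetitor R C₁ C₀) :
    sInf {d | ∃ A B C : Set E, IsCompetitor R A₁ A ∧ IsCompetitor R B₁ B ∧ IsCompetitor R C₁ C ∧
      volume (sumPairs A₀ B₀ C₀) ≤ volume (sumPairs A B C) ∧
      volume (A \ A₁) + volume (B \ B₁) + volume (C \ C₁) = d} = 0 := by
  set S := {d | ∃ A B C : Set E, IsCompetitor R A₁ A ∧ IsCompetitor R B₁ B ∧ IsCompetitor R C₁ C ∧
      volume (sumPairs A₀ B₀ C₀) ≤ volume (sumPairs A B C) ∧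
      volume (A \ A₁) + volume (B \ B₁) + volume (C \ C₁) = d}
  by_contra hne
  set δ := sInf S
  have hfin : ∀ {C A : Set E}, IsCompetitor R C A → volume (A \ C) ≠ ⊤ := fun h =>
    measure_ne_top_of_subset (sdiff_subset.trans h.subset) measure_closedBall_lt_top.ne
  have hδ : δ ≠ ⊤ := ne_top_of_le_ne_top
    (by finiteness [hfin hA₀, hfin hB₀, hfin hC₀])
    (sInf_le ⟨A₀, B₀, C₀, hA₀, hB₀, hC₀, le_rfl, rfl⟩)
  have hδ3 : δ / 3 ≠ 0 := by simp [hne]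
  obtain ⟨q, hq0, hq⟩ := ENNReal.exists_nnreal_pos_mul_lt
    (measure_closedBall_lt_top (μ := volume) (x := (0 : E)) (r := 2 * R)).ne (mul_ne_zero hδ3 hδ3)
  obtain ⟨_, ⟨A, B, C, hA, hB, hC, hABC, rfl⟩, hlt⟩ := sInf_lt_iff.1
    (ENNReal.lt_add_right hδ (ENNReal.coe_ne_zero.2 hq0.ne') : δ < δ + q)
  have hle : δ ≤ volume (A \ A₁) + volume (B \ B₁) + volume (C \ C₁) :=
    sInf_le ⟨A, B, C, hA, hB, hC, hABC, rfl⟩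
  obtain ⟨z, hz, hdec⟩ : ∃ z : E, ‖z‖ = 1 ∧
      volume (steinerSymm z A \ A₁) + volume (steinerSymm z B \ B₁) +
        volume (steinerSymm z C \ C₁) + q ≤
      volume (A \ A₁) + volume (B \ B₁) + volume (C \ C₁) := by
    have hlarge : δ / 3 ≤ volume (A \ A₁) ∨ δ / 3 ≤ volume (B \ B₁) ∨ δ / 3 ≤ volume (C \ C₁) := by
      by_contra! h
      refine absurd hle (not_le.2 ?_)
      calc _ < δ / 3 + δ / 3 + δ / 3 :=
            ENNReal.add_lt_add (ENNReal.add_lt_add h.1 h.2.1) h.2.2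
        _ = δ := ENNReal.add_thirds δ
    rcases hlarge with h | h | h
    · obtain ⟨z, hz, hz'⟩ := exists_volume_steinerSymm_sdiff_add_le hA.measurableSet hA₁m hA₁
        hA.subset hA₁R hA.volume_eq h hq
      refine ⟨z, hz, ?_⟩
      calc _ = (volume (steinerSymm z A \ A₁) + q) + volume (steinerSymm z B \ B₁) +
            volume (steinerSymm z C \ C₁) := by ring
        _ ≤ _ := add_le_add (add_le_add hz' (hB.volume_steinerSymm_sdiff_le hB₁m hB₁ hz))
            (hC.volume_steinerSymm_sdiff_le hC₁m hC₁ hz)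
    · obtain ⟨z, hz, hz'⟩ := exists_volume_steinerSymm_sdiff_add_le hB.measurableSet hB₁m hB₁
        hB.subset hB₁R hB.volume_eq h hq
      refine ⟨z, hz, ?_⟩
      calc _ = volume (steinerSymm z A \ A₁) + (volume (steinerSymm z B \ B₁) + q) +
            volume (steinerSymm z C \ C₁) := by ring
        _ ≤ _ := add_le_add (add_le_add (hA.volume_steinerSymm_sdiff_le hA₁m hA₁ hz) hz')
            (hC.volume_steinerSymm_sdiff_le hC₁m hC₁ hz)
    · obtain ⟨z, hz, hz'⟩ := exists_volume_steinerSymm_sdiff_add_le hC.measurableSet hC₁m hC₁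
        hC.subset hC₁R hC.volume_eq h hq
      refine ⟨z, hz, ?_⟩
      rw [add_assoc]
      exact add_le_add (add_le_add (hA.volume_steinerSymm_sdiff_le hA₁m hA₁ hz)
        (hB.volume_steinerSymm_sdiff_le hB₁m hB₁ hz)) hz'
  have hmem : δ ≤ volume (steinerSymm z A \ A₁) + volume (steinerSymm z B \ B₁) +
      volume (steinerSymm z C \ C₁) :=
    sInf_le ⟨_, _, _, hA.steinerSymm hz, hB.steinerSymm hz, hC.steinerSymm hz,
      hABC.trans (volume_sumPairs_le_steinerSymm hz hA.measurableSet hB.measurableSet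
        hC.measurableSet hA.isBounded hB.isBounded hC.isBounded), rfl⟩
  exact absurd ((add_le_add_left hmem _).trans hdec) (not_le.2 hlt)

lemma volume_sumPairs_le_add {A B C A₁ B₁ C₁ : Set E} (hA : MeasurableSet A)
    (hB : MeasurableSet B) (hC : MeasurableSet C) (hC₁ : MeasurableSet C₁) {V : ℝ≥0∞}
    (hAV : volume A ≤ V) (hBV : volume B ≤ V) :
    volume (sumPairs A B C) ≤ volume (sumPairs A₁ B₁ C₁) +
      (volume (A \ A₁) + volume (B \ B₁) + volume (C \ C₁)) * V := by
  have hsub : sumPairs A B C ⊆ sumPairs A₁ B₁ C₁ ∪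
      (sumPairs (A \ A₁) B C ∪ sumPairs A (B \ B₁) C ∪ sumPairs A B (C \ C₁)) := by
    rintro p ⟨h1, h2, h3⟩
    by_cases h1' : p.1 ∈ A₁
    · by_cases h2' : p.2 ∈ B₁
      · by_cases h3' : p.1 + p.2 ∈ C₁
        · exact Or.inl ⟨h1', h2', h3'⟩
        · exact Or.inr (Or.inr ⟨h1, h2, h3, h3'⟩)
      · exact Or.inr (Or.inl (Or.inr ⟨h1, ⟨h2, h2'⟩, h3⟩))
    · exact Or.inr (Or.inl (Or.inl ⟨⟨h1, h1'⟩, h2, h3⟩))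
  refine (measure_mono hsub).trans ((measure_union_le _ _).trans (add_le_add_right ?_ _))
  rw [add_mul, add_mul]
  refine (measure_union_le _ _).trans (add_le_add ((measure_union_le _ _).trans
    (add_le_add ?_ ?_)) ?_)
  · exact (measure_sumPairs_le₁₂ volume _ _ _).trans (by gcongr)
  · rw [mul_comm]
    exact (measure_sumPairs_le₁₂ volume _ _ _).trans (by gcongr)
  · rw [mul_comm]
    exact (measure_sumPairs_le₁₃ volume hA hB (hC.diff hC₁)).trans (by gcongr)

lemma IsCompetitor.volume_sumPairs_le {R : ℝ} {A B C A₁ B₁ C₁ : Set E}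
    (hA₁m : MeasurableSet A₁) (hB₁m : MeasurableSet B₁) (hC₁m : MeasurableSet C₁)
    (hA₁ : IsCenteredBall A₁) (hB₁ : IsCenteredBall B₁) (hC₁ : IsCenteredBall C₁)
    (hA₁R : A₁ ⊆ Metric.closedBall 0 R) (hB₁R : B₁ ⊆ Metric.closedBall 0 R)
    (hC₁R : C₁ ⊆ Metric.closedBall 0 R) (hA : IsCompetitor R A₁ A)
    (hB : IsCompetitor R B₁ B) (hC : IsCompetitor R C₁ C) :
    volume (sumPairs A B C) ≤ volume (sumPairs A₁ B₁ C₁) := by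
  have hinf := sInf_volume_sdiff_eq_zero hA₁m hB₁m hC₁m hA₁ hB₁ hC₁ hA₁R hB₁R hC₁R hA hB hC
  refine ENNReal.le_of_forall_pos_le_add fun ε hε _ => ?_
  obtain ⟨η, hη0, hη⟩ := ENNReal.exists_nnreal_pos_mul_lt
    (measure_closedBall_lt_top (μ := volume) (x := (0 : E)) (r := R)).ne
    (ENNReal.coe_ne_zero.2 hε.ne')
  obtain ⟨_, ⟨A', B', C', hA', hB', hC', hle, rfl⟩, hlt⟩ :=
    sInf_lt_iff.1 (hinf.trans_lt (ENNReal.coe_pos.2 hη0))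
  refine hle.trans ((volume_sumPairs_le_add (A₁ := A₁) (B₁ := B₁) hA'.measurableSet
    hB'.measurableSet hC'.measurableSet
    hC₁m (measure_mono hA'.subset) (measure_mono hB'.subset)).trans ?_)
  gcongr
  exact (mul_le_mul_left hlt.le _).trans hη.le

end Steiner

section Rearrangement

variable {n : ℕ}

lemma measurable_volume_ball_norm :
    Measurable fun x : EuclideanSpace ℝ (Fin n) =>
      volume (Metric.ball (0 : EuclideanSpace ℝ (Fin n)) ‖x‖) :=
  (Monotone.measurable fun _ _ h => measure_mono (Metric.ball_subset_ball h)).comp measurable_norm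

lemma measurableSet_ballRearrange (A : Set (EuclideanSpace ℝ (Fin n))) :
    MeasurableSet (ballRearrange n A) :=
  measurableSet_lt measurable_volume_ball_norm measurable_const

lemma isCenteredBall_ballRearrange (A : Set (EuclideanSpace ℝ (Fin n))) :
    IsCenteredBall (ballRearrange n A) :=
  fun _ hx _ hy => (measure_mono (Metric.ball_subset_ball hy)).trans_lt hx

lemma ballRearrange_mono {A B : Set (EuclideanSpace ℝ (Fin n))} (h : A ⊆ B) :
    ballRearrange n A ⊆ ballRearrange n B :=
  fun _ hx => lt_of_lt_of_le hx (measure_mono h)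

lemma ballRearrange_subset_closedBall {A : Set (EuclideanSpace ℝ (Fin n))} {R : ℝ}
    (h : A ⊆ Metric.closedBall 0 R) : ballRearrange n A ⊆ Metric.closedBall 0 R := by
  intro x hx
  rw [mem_closedBall_zero_iff]
  by_contra! hlt
  exact absurd hx (not_lt.2 (measure_mono (h.trans (Metric.closedBall_subset_ball hlt))))

lemma ballRearrange_zero (A : Set (EuclideanSpace ℝ (Fin 0))) : ballRearrange 0 A = A := by
  rcases Set.eq_empty_or_nonempty A with rfl | hA
  · ext x
    simp [ballRearrange]
  · rw [Subsingleton.eq_univ_of_nonempty hA]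
    ext x
    simp [ballRearrange, Subsingleton.elim x 0, NeZero.ne]

lemma volume_ballRearrange (A : Set (EuclideanSpace ℝ (Fin n))) :
    volume (ballRearrange n A) = volume A := by
  rcases Nat.eq_zero_or_pos n with rfl | hn
  · rw [ballRearrange_zero]
  have : Nonempty (Fin n) := ⟨⟨0, hn⟩⟩
  rcases eq_or_ne (volume A) ⊤ with hA | hA
  · rw [hA, ← measure_univ_of_isAddLeftInvariant (volume : Measure (EuclideanSpace ℝ (Fin n)))]
    congr 1
    exact eq_univ_of_forall fun x => measure_ball_lt_top.trans_eq hA.symm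
  set c := volume (Metric.ball (0 : EuclideanSpace ℝ (Fin n)) 1) with hc
  have hc0 : c ≠ 0 := (Metric.measure_ball_pos volume _ one_pos).ne'
  have hct : c ≠ ⊤ := measure_ball_lt_top.ne
  have hball : ∀ r : ℝ, 0 ≤ r → volume (Metric.ball (0 : EuclideanSpace ℝ (Fin n)) r) =
      ENNReal.ofReal (r ^ n) * c := by
    intro r hr
    rw [Measure.addHaar_ball _ _ hr, finrank_euclideanSpace_fin]
  set w := (volume A / c).toReal
  set r := w ^ ((n : ℝ)⁻¹)
  have hr : 0 ≤ r := by positivity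
  have hrA : volume (Metric.ball (0 : EuclideanSpace ℝ (Fin n)) r) = volume A := by
    rw [hball r hr, Real.rpow_inv_natCast_pow ENNReal.toReal_nonneg hn.ne',
      ENNReal.ofReal_toReal (ENNReal.div_ne_top hA hc0), ENNReal.div_mul_cancel hc0 hct]
  have : ballRearrange n A = Metric.ball 0 r := by
    ext x
    rw [ballRearrange, mem_ofPred_eq, mem_ball_zero_iff, ← hrA, hball r hr, hball _ (norm_nonneg x),
      ENNReal.mul_lt_mul_iff_left hc0 hct, ENNReal.ofReal_lt_ofReal_iff_of_nonneg (by positivity),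
      pow_lt_pow_iff_left₀ (norm_nonneg x) hr hn.ne']
  rw [this, hrA]

/-- Riesz's rearrangement inequality for sets. -/
lemma volume_sumPairs_le_ballRearrange {A B C : Set (EuclideanSpace ℝ (Fin n))}
    (hA : MeasurableSet A) (hB : MeasurableSet B) (hC : MeasurableSet C) :
    volume (sumPairs A B C) ≤
      volume (sumPairs (ballRearrange n A) (ballRearrange n B) (ballRearrange n C)) := by
  set b : ℕ → Set (EuclideanSpace ℝ (Fin n)) := fun k => Metric.closedBall 0 k
  have hb : Monotone b := fun i j h => Metric.closedBall_subset_closedBall (Nat.cast_le.2 h)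
  have hU : sumPairs A B C = ⋃ k, sumPairs (A ∩ b k) (B ∩ b k) (C ∩ b k) := by
    refine Subset.antisymm (fun p hp => ?_) (iUnion_subset fun k =>
      sumPairs_mono inter_subset_left inter_subset_left inter_subset_left)
    obtain ⟨k, hk⟩ := exists_nat_ge (max ‖p.1‖ (max ‖p.2‖ ‖p.1 + p.2‖))
    simp only [max_le_iff] at hk
    refine mem_iUnion.2 ⟨k, ⟨hp.1, ?_⟩, ⟨hp.2.1, ?_⟩, hp.2.2, ?_⟩
    all_goals simp only [b, mem_closedBall_zero_iff, hk]
  have hmono : Monotone fun k => sumPairs (A ∩ b k) (B ∩ b k) (C ∩ b k) := fun i j h =>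
    sumPairs_mono (inter_subset_inter_right _ (hb h)) (inter_subset_inter_right _ (hb h))
      (inter_subset_inter_right _ (hb h))
  rw [hU, hmono.measure_iUnion]
  refine iSup_le fun k => ?_
  have hcomp : ∀ {D : Set (EuclideanSpace ℝ (Fin n))}, MeasurableSet D →
      IsCompetitor (k : ℝ) (ballRearrange n (D ∩ b k)) (D ∩ b k) := fun hD =>
    ⟨hD.inter Metric.isClosed_closedBall.measurableSet, inter_subset_right,
      (volume_ballRearrange _).symm⟩
  refine (IsCompetitor.volume_sumPairs_le (measurableSet_ballRearrange _)
    (measurableSet_ballRearrange _) (measurableSet_ballRearrange _)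
    (isCenteredBall_ballRearrange _) (isCenteredBall_ballRearrange _)
    (isCenteredBall_ballRearrange _) (ballRearrange_subset_closedBall inter_subset_right)
    (ballRearrange_subset_closedBall inter_subset_right)
    (ballRearrange_subset_closedBall inter_subset_right)
    (hcomp hA) (hcomp hB) (hcomp hC)).trans (measure_mono (sumPairs_mono ?_ ?_ ?_))
  all_goals exact ballRearrange_mono inter_subset_left

lemma measurableSet_superlevel {f : EuclideanSpace ℝ (Fin n) → ℝ≥0∞} (hf : Measurable f) :
    MeasurableSet {p : EuclideanSpace ℝ (Fin n) × ℝ | p.1 ∈ {x | ENNReal.ofReal p.2 < f x}} :=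
  measurableSet_lt (ENNReal.measurable_ofReal.comp measurable_snd) (hf.comp measurable_fst)

lemma measurableSet_ballRearrange_superlevel (f : EuclideanSpace ℝ (Fin n) → ℝ≥0∞) :
    MeasurableSet {p : EuclideanSpace ℝ (Fin n) × ℝ |
      p.1 ∈ ballRearrange n {x | ENNReal.ofReal p.2 < f x}} := by
  have h : Antitone fun t : ℝ => volume {x | ENNReal.ofReal t < f x} := fun s t h =>
    measure_mono fun x hx => lt_of_le_of_lt (ENNReal.ofReal_le_ofReal h) hx
  exact measurableSet_lt (measurable_volume_ball_norm.comp measurable_fst)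
    (h.measurable.comp measurable_snd)

lemma lintegral_layer_eq {f : EuclideanSpace ℝ (Fin n) → ℝ≥0∞} (x : EuclideanSpace ℝ (Fin n)) :
    ∫⁻ t in Ioi (0 : ℝ), {x | ENNReal.ofReal t < f x}.indicator 1 x = f x := by
  have := setLIntegral_Ioi_indicator_ofReal_lt (f x) le_rfl
  rw [ENNReal.ofReal_zero, tsub_zero] at this
  exact this

lemma lintegral_layer_mul {U : ℝ → Set (EuclideanSpace ℝ (Fin n))}
    (hU : MeasurableSet {p : EuclideanSpace ℝ (Fin n) × ℝ | p.1 ∈ U p.2})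
    {K : EuclideanSpace ℝ (Fin n) → ℝ≥0∞} (hK : Measurable K) (τ : ℝ) :
    ∫⁻ x, (∫⁻ t in Ioi τ, (U t).indicator 1 x) * K x = ∫⁻ t in Ioi τ, ∫⁻ x in U t, K x := by
  have hind : Measurable fun p : EuclideanSpace ℝ (Fin n) × ℝ =>
      (U p.2).indicator (1 : EuclideanSpace ℝ (Fin n) → ℝ≥0∞) p.1 :=
    measurable_one.indicator hU
  calc _ = ∫⁻ x, ∫⁻ t in Ioi τ, (U t).indicator 1 x * K x := by
        refine lintegral_congr fun x => ?_
        exact (lintegral_mul_const _ (hind.comp measurable_prodMk_left)).symm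
    _ = ∫⁻ t in Ioi τ, ∫⁻ x, (U t).indicator 1 x * K x :=
        lintegral_lintegral_swap (hind.mul (hK.comp measurable_fst)).aemeasurable
    _ = _ := by
        refine lintegral_congr fun t => ?_
        have hUt : MeasurableSet (U t) := measurable_prodMk_right hU
        rw [← lintegral_indicator hUt]
        refine lintegral_congr fun x => ?_
        by_cases hx : x ∈ U t <;> simp [hx]

lemma measurable_symmRearr (f : EuclideanSpace ℝ (Fin n) → ℝ≥0∞) : Measurable (symmRearr n f) :=
  Measurable.lintegral_prod_right'
    (f := fun p : EuclideanSpace ℝ (Fin n) × ℝ =>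
      (ballRearrange n {x | ENNReal.ofReal p.2 < f x}).indicator 1 p.1)
    (measurable_one.indicator (measurableSet_ballRearrange_superlevel f))

lemma lintegral_mul_eq_layer {f K : EuclideanSpace ℝ (Fin n) → ℝ≥0∞} (hf : Measurable f)
    (hK : Measurable K) :
    ∫⁻ x, f x * K x = ∫⁻ t in Ioi (0 : ℝ), ∫⁻ x in {x | ENNReal.ofReal t < f x}, K x := by
  rw [← lintegral_layer_mul (measurableSet_superlevel hf) hK]
  simp_rw [lintegral_layer_eq]

lemma lintegral_symmRearr_mul (f : EuclideanSpace ℝ (Fin n) → ℝ≥0∞)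
    {K : EuclideanSpace ℝ (Fin n) → ℝ≥0∞} (hK : Measurable K) :
    ∫⁻ x, symmRearr n f x * K x = ∫⁻ t in Ioi (0 : ℝ),
      ∫⁻ x in ballRearrange n {x | ENNReal.ofReal t < f x}, K x :=
  lintegral_layer_mul (measurableSet_ballRearrange_superlevel f) hK 0

lemma symmRearr_sub_ofReal (f : EuclideanSpace ℝ (Fin n) → ℝ≥0∞) {τ : ℝ} (hτ : 0 ≤ τ)
    (x : EuclideanSpace ℝ (Fin n)) :
    symmRearr n f x - ENNReal.ofReal τ =
      ∫⁻ t in Ioi τ, (ballRearrange n {x | ENNReal.ofReal t < f x}).indicator 1 x := by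
  have hsplit : symmRearr n f x =
      (∫⁻ t in Ioc 0 τ, (ballRearrange n {x | ENNReal.ofReal t < f x}).indicator 1 x) +
        ∫⁻ t in Ioi τ, (ballRearrange n {x | ENNReal.ofReal t < f x}).indicator 1 x := by
    rw [symmRearr, ← Ioc_union_Ioi_eq_Ioi hτ,
      lintegral_union measurableSet_Ioi (Ioc_disjoint_Ioi le_rfl)]
  have hτvol : ∫⁻ _ in Ioc 0 τ, (1 : ℝ≥0∞) = ENNReal.ofReal τ := by simp
  by_cases h : ∃ t ∈ Ioi τ, x ∈ ballRearrange n {x | ENNReal.ofReal t < f x}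
  · obtain ⟨t, ht, hx⟩ := h
    rw [hsplit, setLIntegral_congr_fun (g := fun _ => (1 : ℝ≥0∞)) measurableSet_Ioc, hτvol,
      ENNReal.add_sub_cancel_left ENNReal.ofReal_ne_top]
    intro s hs
    refine indicator_of_mem (ballRearrange_mono (fun y hy => ?_) hx) _
    exact (ENNReal.ofReal_le_ofReal (hs.2.trans (le_of_lt ht))).trans_lt hy
  · push Not at h
    have h0 : ∫⁻ t in Ioi τ, (ballRearrange n {x | ENNReal.ofReal t < f x}).indicator
        (1 : EuclideanSpace ℝ (Fin n) → ℝ≥0∞) x = 0 := by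
      rw [setLIntegral_congr_fun (g := fun _ => (0 : ℝ≥0∞)) measurableSet_Ioi fun t ht =>
        indicator_of_notMem (h t ht) _, lintegral_zero]
    rw [hsplit, h0, add_zero, tsub_eq_zero_iff_le, ← hτvol]
    exact lintegral_mono fun t => indicator_le (fun _ _ => le_rfl) x

lemma lintegral_symmRearr_sub {f : EuclideanSpace ℝ (Fin n) → ℝ≥0∞} (hf : Measurable f)
    (τ : ℝ≥0∞) : ∫⁻ x, (symmRearr n f x - τ) = ∫⁻ x, (f x - τ) := by
  rcases eq_or_ne τ ⊤ with rfl | hτ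
  · simp
  have hτ0 : 0 ≤ τ.toReal := ENNReal.toReal_nonneg
  rw [← ENNReal.ofReal_toReal hτ]
  calc _ = ∫⁻ x, ∫⁻ t in Ioi τ.toReal,
          (ballRearrange n {x | ENNReal.ofReal t < f x}).indicator 1 x :=
        lintegral_congr fun x => symmRearr_sub_ofReal f hτ0 x
    _ = ∫⁻ t in Ioi τ.toReal, volume (ballRearrange n {x | ENNReal.ofReal t < f x}) := by
        simpa using lintegral_layer_mul (measurableSet_ballRearrange_superlevel f)
          (measurable_one (α := ℝ≥0∞)) τ.toReal
    _ = ∫⁻ t in Ioi τ.toReal, volume {x | ENNReal.ofReal t < f x} := by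
        simp_rw [volume_ballRearrange]
    _ = ∫⁻ x, ∫⁻ t in Ioi τ.toReal, {x | ENNReal.ofReal t < f x}.indicator 1 x := by
        simpa using (lintegral_layer_mul (measurableSet_superlevel hf)
          (measurable_one (α := ℝ≥0∞)) τ.toReal).symm
    _ = _ := lintegral_congr fun x => setLIntegral_Ioi_indicator_ofReal_lt (f x) hτ0

lemma lintegral_symmRearr {f : EuclideanSpace ℝ (Fin n) → ℝ≥0∞} (hf : Measurable f) :
    ∫⁻ x, symmRearr n f x = ∫⁻ x, f x := by
  simpa using lintegral_symmRearr_sub hf 0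

lemma measurable_conv2 {u f : EuclideanSpace ℝ (Fin n) → ℝ≥0∞} (hu : Measurable u)
    (hf : Measurable f) : Measurable (conv2 n u f) :=
  Measurable.lintegral_prod_right'
    (f := fun p : EuclideanSpace ℝ (Fin n) × EuclideanSpace ℝ (Fin n) => u p.2 * f (p.1 - p.2))
    ((hu.comp measurable_snd).mul (hf.comp (measurable_fst.sub measurable_snd)))

lemma measurable_lintegral_mul_add {f φ : EuclideanSpace ℝ (Fin n) → ℝ≥0∞}
    (hf : Measurable f) (hφ : Measurable φ) : Measurable fun x => ∫⁻ y, f y * φ (x + y) :=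
  Measurable.lintegral_prod_right'
    (f := fun p : EuclideanSpace ℝ (Fin n) × EuclideanSpace ℝ (Fin n) => f p.2 * φ (p.1 + p.2))
    ((hf.comp measurable_snd).mul (hφ.comp (measurable_fst.add measurable_snd)))

lemma lintegral_conv2_mul {u f φ : EuclideanSpace ℝ (Fin n) → ℝ≥0∞} (hu : Measurable u)
    (hf : Measurable f) (hφ : Measurable φ) :
    ∫⁻ z, conv2 n u f z * φ z = ∫⁻ x, u x * ∫⁻ y, f y * φ (x + y) := by
  calc _ = ∫⁻ z, ∫⁻ x, u x * (f (z - x) * φ z) := by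
        refine lintegral_congr fun z => ?_
        have h : Measurable fun x => u x * f (z - x) :=
          hu.mul (hf.comp (measurable_id.const_sub z))
        simp_rw [← mul_assoc]
        exact (lintegral_mul_const _ h).symm
    _ = ∫⁻ x, ∫⁻ z, u x * (f (z - x) * φ z) := by
        refine lintegral_lintegral_swap (Measurable.aemeasurable ?_)
        exact (hu.comp measurable_snd).mul ((hf.comp (measurable_fst.sub measurable_snd)).mul
          (hφ.comp measurable_fst))
    _ = _ := by
        refine lintegral_congr fun x => ?_
        have h : Measurable fun z => f (z - x) * φ z :=
          (hf.comp (measurable_id.sub_const x)).mul hφ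
        rw [lintegral_const_mul _ h]
        congr 1
        rw [← lintegral_add_left_eq_self _ x]
        simp

lemma setLIntegral_conv2 {u f : EuclideanSpace ℝ (Fin n) → ℝ≥0∞} (hu : Measurable u)
    (hf : Measurable f) {C : Set (EuclideanSpace ℝ (Fin n))} (hC : MeasurableSet C) :
    ∫⁻ z in C, conv2 n u f z = ∫⁻ x, u x * ∫⁻ y, f y * C.indicator 1 (x + y) := by
  rw [← lintegral_conv2_mul hu hf (measurable_one.indicator hC), ← lintegral_indicator hC]
  refine lintegral_congr fun z => ?_
  by_cases hz : z ∈ C <;> simp [hz]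

lemma lintegral_conv2 {u f : EuclideanSpace ℝ (Fin n) → ℝ≥0∞} (hu : Measurable u)
    (hf : Measurable f) : ∫⁻ z, conv2 n u f z = (∫⁻ x, u x) * ∫⁻ y, f y := by
  simpa [lintegral_mul_const _ hu] using lintegral_conv2_mul hu hf measurable_one

lemma lintegral_mul_lintegral_mul_add_comm {u f φ : EuclideanSpace ℝ (Fin n) → ℝ≥0∞}
    (hu : Measurable u) (hf : Measurable f) (hφ : Measurable φ) :
    ∫⁻ x, u x * ∫⁻ y, f y * φ (x + y) = ∫⁻ y, f y * ∫⁻ x, u x * φ (y + x) := by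
  calc _ = ∫⁻ x, ∫⁻ y, u x * (f y * φ (x + y)) := by
        refine lintegral_congr fun x => (lintegral_const_mul _ ?_).symm
        exact hf.mul (hφ.comp (measurable_const_add x))
    _ = ∫⁻ y, ∫⁻ x, u x * (f y * φ (x + y)) := by
        refine lintegral_lintegral_swap (Measurable.aemeasurable ?_)
        exact (hu.comp measurable_fst).mul ((hf.comp measurable_snd).mul
          (hφ.comp (measurable_fst.add measurable_snd)))
    _ = _ := by
        refine lintegral_congr fun y => ?_
        have h : Measurable fun x => u x * φ (y + x) := hu.mul (hφ.comp (measurable_const_add y))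
        rw [← lintegral_const_mul _ h]
        refine lintegral_congr fun x => ?_
        rw [add_comm y x]
        ring

lemma setLIntegral_setLIntegral_indicator {A B C : Set (EuclideanSpace ℝ (Fin n))}
    (hA : MeasurableSet A) (hB : MeasurableSet B) (hC : MeasurableSet C) :
    ∫⁻ y in B, ∫⁻ x, A.indicator 1 x * C.indicator 1 (y + x) = volume (sumPairs A B C) := by
  have hS := measurableSet_sumPairs hA hB hC
  rw [← lintegral_indicator_one hS, Measure.volume_eq_prod,
    lintegral_prod_symm _ (measurable_one.indicator hS).aemeasurable, ← lintegral_indicator hB]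
  refine lintegral_congr fun y => ?_
  by_cases hy : y ∈ B
  · rw [indicator_of_mem hy]
    refine lintegral_congr fun x => ?_
    by_cases hx : x ∈ A <;> by_cases hxy : x + y ∈ C <;>
      simp [sumPairs, hx, hy, hxy, add_comm y x]
  · simp [hy, sumPairs]

lemma setLIntegral_lintegral_mul_indicator {f : EuclideanSpace ℝ (Fin n) → ℝ≥0∞}
    (hf : Measurable f) {A C : Set (EuclideanSpace ℝ (Fin n))} (hA : MeasurableSet A)
    (hC : MeasurableSet C) :
    ∫⁻ x in A, ∫⁻ y, f y * C.indicator 1 (x + y) =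
      ∫⁻ y, f y * ∫⁻ x, A.indicator 1 x * C.indicator 1 (y + x) := by
  rw [← lintegral_mul_lintegral_mul_add_comm (measurable_one.indicator hA) hf
      (measurable_one.indicator hC),
    ← lintegral_indicator hA]
  refine lintegral_congr fun x => ?_
  by_cases hx : x ∈ A <;> simp [hx]

/-- Riesz's rearrangement inequality for two functions and a set. -/
lemma setLIntegral_conv2_le_symmRearr {u f : EuclideanSpace ℝ (Fin n) → ℝ≥0∞}
    (hu : Measurable u) (hf : Measurable f) {C : Set (EuclideanSpace ℝ (Fin n))}
    (hC : MeasurableSet C) :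
    ∫⁻ z in C, conv2 n u f z ≤
      ∫⁻ z in ballRearrange n C, conv2 n (symmRearr n u) (symmRearr n f) z := by
  have hC' := measurableSet_ballRearrange C
  have hI := (measurable_one (α := ℝ≥0∞)).indicator hC
  have hI' := (measurable_one (α := ℝ≥0∞)).indicator hC'
  have hf' := measurable_symmRearr f
  rw [setLIntegral_conv2 hu hf hC, setLIntegral_conv2 (measurable_symmRearr u) hf' hC',
    lintegral_mul_eq_layer hu (measurable_lintegral_mul_add hf hI),
    lintegral_symmRearr_mul u (measurable_lintegral_mul_add hf' hI')]
  refine lintegral_mono fun s => ?_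
  have hA : MeasurableSet {x | ENNReal.ofReal s < u x} := measurableSet_lt measurable_const hu
  have hA' := measurableSet_ballRearrange {x | ENNReal.ofReal s < u x}
  have hind := measurable_lintegral_mul_add (measurable_one.indicator hA) hI
  have hind' := measurable_lintegral_mul_add (measurable_one.indicator hA') hI'
  rw [setLIntegral_lintegral_mul_indicator hf hA hC,
    setLIntegral_lintegral_mul_indicator hf' hA' hC', lintegral_mul_eq_layer hf hind,
    lintegral_symmRearr_mul f hind']
  refine lintegral_mono fun t => ?_
  have hB : MeasurableSet {x | ENNReal.ofReal t < f x} := measurableSet_lt measurable_const hf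
  rw [setLIntegral_setLIntegral_indicator hA hB hC,
    setLIntegral_setLIntegral_indicator hA' (measurableSet_ballRearrange _) hC']
  exact volume_sumPairs_le_ballRearrange hA hB hC

/-- A function whose value at `x` is a nonincreasing function of `‖x‖`. -/
def IsRadiallyDecreasing (u : EuclideanSpace ℝ (Fin n) → ℝ≥0∞) : Prop :=
  ∀ ⦃x y⦄, ‖x‖ ≤ ‖y‖ → u y ≤ u x

lemma IsCenteredBall.isRadiallyDecreasing_indicator {C : Set (EuclideanSpace ℝ (Fin n))}
    (hC : IsCenteredBall C) : IsRadiallyDecreasing (C.indicator 1) := by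
  intro x y hxy
  by_cases hy : y ∈ C
  · rw [indicator_of_mem hy, indicator_of_mem (hC hy hxy)]
    exact le_rfl
  · simp [hy]

lemma IsRadiallyDecreasing.isCenteredBall {u : EuclideanSpace ℝ (Fin n) → ℝ≥0∞}
    (hu : IsRadiallyDecreasing u) (t : ℝ≥0∞) : IsCenteredBall {x | t < u x} :=
  fun _ hx _ hy => lt_of_lt_of_le hx (hu hy)

lemma isRadiallyDecreasing_symmRearr (f : EuclideanSpace ℝ (Fin n) → ℝ≥0∞) :
    IsRadiallyDecreasing (symmRearr n f) := fun _ _ hxy =>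
  lintegral_mono fun _ => (isCenteredBall_ballRearrange _).isRadiallyDecreasing_indicator hxy

/-- The reflection across the perpendicular bisector of two points. -/
lemma exists_measurePreserving_swap {x x' : EuclideanSpace ℝ (Fin n)} (hne : x ≠ x')
    (hxx' : ‖x‖ ≤ ‖x'‖) :
    ∃ σ : EuclideanSpace ℝ (Fin n) → EuclideanSpace ℝ (Fin n),
      MeasurePreserving σ volume volume ∧ ∀ y, ‖x - σ y‖ = ‖x' - y‖ ∧ ‖x' - σ y‖ = ‖x - y‖ ∧
        (‖x - y‖ ≤ ‖x' - y‖ → ‖y‖ ≤ ‖σ y‖) ∧ (‖x' - y‖ ≤ ‖x - y‖ → ‖σ y‖ ≤ ‖y‖) := by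
  set v := x' - x with hv
  have hv0 : 0 < ‖v‖ ^ 2 := by
    have : v ≠ 0 := sub_ne_zero.2 hne.symm
    positivity
  set R := (Submodule.span ℝ {v})ᗮ.reflection
  have hR : ∀ w, R w = w - (2 * (inner ℝ v w / ‖v‖ ^ 2)) • v := by
    intro w
    rw [Submodule.reflection_orthogonal_apply, Submodule.reflection_singleton_apply]
    simp only [RCLike.ofReal_real_eq_id, id_eq, neg_sub, two_smul, two_mul, add_smul]
  have hRv : R (x' - x) = x - x' := by
    rw [Submodule.reflection_orthogonalComplement_singleton_eq_neg, hv, neg_sub]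
  refine ⟨fun y => x' + R (y - x), (measurePreserving_add_left volume x').comp
    (R.measurePreserving.comp (measurePreserving_sub_right volume x)), fun y => ?_⟩
  have h1 : ‖x - (x' + R (y - x))‖ = ‖x' - y‖ := by
    rw [← R.norm_map (x' - y), show x' - y = (x' - x) - (y - x) by abel, map_sub R (x' - x), hRv]
    congr 1
    abel
  have h2 : ‖x' - (x' + R (y - x))‖ = ‖x - y‖ := by
    rw [sub_add_cancel_left, norm_neg, R.norm_map, norm_sub_rev]
  set s := 1 - 2 * (inner ℝ v (y - x) / ‖v‖ ^ 2) with hs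
  have hsv : s * ‖v‖ ^ 2 = ‖v‖ ^ 2 - 2 * inner ℝ v (y - x) := by
    rw [hs, sub_mul, one_mul, mul_assoc, div_mul_cancel₀ _ hv0.ne']
  have hσ : x' + R (y - x) = y + s • v := by
    rw [hR, hs, sub_smul, one_smul, hv]
    abel
  have h3 : ‖x' - y‖ ^ 2 - ‖x - y‖ ^ 2 = s * ‖v‖ ^ 2 := by
    rw [hsv, show x' - y = v - (y - x) by rw [hv]; abel, norm_sub_sq_real, norm_sub_rev x y]
    ring
  have h4 : ‖x' + R (y - x)‖ ^ 2 - ‖y‖ ^ 2 = s * (‖x'‖ ^ 2 - ‖x‖ ^ 2) := by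
    rw [hσ, norm_add_sq_real, norm_smul, mul_pow, Real.norm_eq_abs, sq_abs, real_inner_smul_right,
      show x' = x + v by rw [hv]; abel, norm_add_sq_real, real_inner_comm v y,
      real_inner_comm v x]
    rw [inner_sub_right] at hsv
    linear_combination s * hsv
  have h5 : 0 ≤ ‖x'‖ ^ 2 - ‖x‖ ^ 2 := by nlinarith [norm_nonneg x]
  refine ⟨h1, h2, fun h => ?_, fun h => ?_⟩
  · refine le_of_sq_le_sq ?_ (norm_nonneg _)
    have : 0 ≤ s := by
      refine nonneg_of_mul_nonneg_left (b := ‖v‖ ^ 2) ?_ hv0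
      nlinarith [norm_nonneg (x - y)]
    nlinarith [mul_nonneg this h5]
  · refine le_of_sq_le_sq ?_ (norm_nonneg _)
    have : 0 ≤ -s := by
      refine nonneg_of_mul_nonneg_left (b := ‖v‖ ^ 2) ?_ hv0
      nlinarith [norm_nonneg (x' - y)]
    nlinarith [mul_nonneg this h5]

lemma mul_add_mul_le_of_le_of_le {a b c d : ℝ≥0∞} (hba : b ≤ a) (hdc : d ≤ c) :
    a * d + b * c ≤ a * c + b * d := by
  obtain ⟨p, rfl⟩ := exists_add_of_le hba
  obtain ⟨q, rfl⟩ := exists_add_of_le hdc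
  calc (b + p) * d + b * (d + q) ≤ (b + p) * d + b * (d + q) + p * q := le_self_add
    _ = _ := by ring

lemma IsRadiallyDecreasing.conv2_isRadiallyDecreasing {U K : EuclideanSpace ℝ (Fin n) → ℝ≥0∞}
    (hU : Measurable U) (hK : Measurable K) (hU' : IsRadiallyDecreasing U)
    (hK' : IsRadiallyDecreasing K) : IsRadiallyDecreasing (conv2 n U K) := by
  intro x x' hxx'
  rcases eq_or_ne x x' with rfl | hne
  · exact le_rfl
  obtain ⟨σ, hσ, h⟩ := exists_measurePreserving_swap hne hxx'
  have hKn : ∀ {a b : EuclideanSpace ℝ (Fin n)}, ‖a‖ = ‖b‖ → K a = K b := fun hab =>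
    le_antisymm (hK' hab.ge) (hK' hab.le)
  have hm : ∀ z, Measurable fun y => U y * K (z - y) := fun z =>
    hU.mul (hK.comp (measurable_id.const_sub z))
  have hsum : ∀ z, 2 * conv2 n U K z =
      ∫⁻ y, (U y * K (z - y) + U (σ y) * K (z - σ y)) := by
    intro z
    rw [lintegral_add_left (hm z), hσ.lintegral_comp (hm z), two_mul]
    rfl
  rw [← ENNReal.mul_le_mul_iff_right two_ne_zero ENNReal.ofNat_ne_top, hsum, hsum]
  refine lintegral_mono fun y => ?_
  obtain ⟨h1, h2, h3, h4⟩ := h y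
  simp only [hKn h1, hKn h2]
  rcases le_total ‖x - y‖ ‖x' - y‖ with hle | hle
  · exact mul_add_mul_le_of_le_of_le (hU' (h3 hle)) (hK' hle)
  · rw [add_comm, add_comm (U y * K (x - y))]
    exact mul_add_mul_le_of_le_of_le (hU' (h4 hle)) (hK' hle)

lemma IsRadiallyDecreasing.lintegral_mul_add {U K : EuclideanSpace ℝ (Fin n) → ℝ≥0∞}
    (hU : Measurable U) (hK : Measurable K) (hU' : IsRadiallyDecreasing U)
    (hK' : IsRadiallyDecreasing K) : IsRadiallyDecreasing fun x => ∫⁻ y, U y * K (x + y) := by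
  convert IsRadiallyDecreasing.conv2_isRadiallyDecreasing hU hK hU' hK' using 2 with x
  rw [conv2, ← lintegral_neg_eq_self]
  refine lintegral_congr fun y => ?_
  rw [le_antisymm (hU' (norm_neg y).ge) (hU' (norm_neg y).le), sub_eq_add_neg]

/-- Comparison of all the integrals of the excess over a level. -/
def ExcessLE (u U : EuclideanSpace ℝ (Fin n) → ℝ≥0∞) : Prop :=
  ∀ τ : ℝ≥0∞, ∫⁻ x, (u x - τ) ≤ ∫⁻ x, (U x - τ)

lemma ExcessLE.setLIntegral_le {u U : EuclideanSpace ℝ (Fin n) → ℝ≥0∞} (h : ExcessLE u U)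
    (hU : IsRadiallyDecreasing U) {B : Set (EuclideanSpace ℝ (Fin n))} (hB : MeasurableSet B)
    (hB' : IsCenteredBall B) : ∫⁻ x in B, u x ≤ ∫⁻ x in B, U x := by
  set τ := ⨆ y ∈ Bᶜ, U y with hτ
  have hτB : ∀ x ∈ B, τ ≤ U x := fun x hx => iSup₂_le fun y hy =>
    hU (not_lt.1 fun hlt => hy (hB' hx hlt.le))
  have hτB' : ∀ x, x ∉ B → U x - τ = 0 := fun x hx =>
    tsub_eq_zero_of_le (le_iSup₂ (f := fun y (_ : y ∈ Bᶜ) => U y) x hx)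
  calc ∫⁻ x in B, u x ≤ ∫⁻ x in B, (τ + (u x - τ)) := lintegral_mono fun x => le_add_tsub
    _ ≤ (∫⁻ _ in B, τ) + ∫⁻ x, (u x - τ) := by
        rw [lintegral_add_left measurable_const]
        exact add_le_add_right (setLIntegral_le_lintegral _ _) _
    _ ≤ (∫⁻ _ in B, τ) + ∫⁻ x, (U x - τ) := add_le_add_right (h τ) _
    _ = (∫⁻ _ in B, τ) + ∫⁻ x in B, (U x - τ) := by
        rw [setLIntegral_eq_of_support_subset (s := B) (f := fun x => U x - τ)]
        intro x hx
        by_contra hxB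
        exact hx (hτB' x hxB)
    _ = ∫⁻ x in B, (τ + (U x - τ)) := (lintegral_add_left measurable_const _).symm
    _ = _ := setLIntegral_congr_fun hB fun x hx => add_tsub_cancel_of_le (hτB x hx)

lemma ExcessLE.lintegral_mul_le {u U K : EuclideanSpace ℝ (Fin n) → ℝ≥0∞} (h : ExcessLE u U)
    (hum : Measurable u) (hUm : Measurable U) (hU : IsRadiallyDecreasing U) (hKm : Measurable K)
    (hK : IsRadiallyDecreasing K) : ∫⁻ x, u x * K x ≤ ∫⁻ x, U x * K x := by
  simp_rw [mul_comm _ (K _)]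
  rw [lintegral_mul_eq_layer hKm hum, lintegral_mul_eq_layer hKm hUm]
  exact lintegral_mono fun t =>
    h.setLIntegral_le hU (measurableSet_lt measurable_const hKm) (hK.isCenteredBall _)

lemma ExcessLE.symmRearr_left {u U : EuclideanSpace ℝ (Fin n) → ℝ≥0∞} (h : ExcessLE u U)
    (hu : Measurable u) : ExcessLE (symmRearr n u) U :=
  fun τ => (lintegral_symmRearr_sub hu τ).trans_le (h τ)

lemma excessLE_symmRearr {f : EuclideanSpace ℝ (Fin n) → ℝ≥0∞} (hf : Measurable f) :
    ExcessLE f (symmRearr n f) := fun τ => (lintegral_symmRearr_sub hf τ).ge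

lemma ExcessLE.conv2_symmRearr {u U f : EuclideanSpace ℝ (Fin n) → ℝ≥0∞} (h : ExcessLE u U)
    (hum : Measurable u) (hUm : Measurable U) (hU : IsRadiallyDecreasing U) (hfm : Measurable f)
    (hu1 : ∫⁻ x, u x ≠ ⊤) (hf1 : ∫⁻ x, f x ≠ ⊤) :
    ExcessLE (conv2 n u f) (conv2 n U (symmRearr n f)) := by
  intro τ
  set H := conv2 n u f
  set H' := conv2 n U (symmRearr n f)
  have hH : Measurable H := measurable_conv2 hum hfm
  have hf' := measurable_symmRearr f
  set E := {x | τ < H x} with hE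
  have hEm : MeasurableSet E := measurableSet_lt measurable_const hH
  have hEm' := measurableSet_ballRearrange E
  have hEsub : E ⊆ {x | τ ≤ H x} := fun x (hx : τ < H x) => hx.le
  have hτE : τ * volume E ≠ ⊤ := by
    refine ne_top_of_le_ne_top (b := ∫⁻ x, H x) ?_
      ((mul_le_mul_right (measure_mono hEsub) τ).trans (mul_meas_ge_le_lintegral hH τ))
    rw [lintegral_conv2 hum hfm]
    exact ENNReal.mul_ne_top hu1 hf1
  have hI := (measurable_one (α := ℝ≥0∞)).indicator hEm'
  refine (ENNReal.add_le_add_iff_right hτE).1 ?_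
  calc (∫⁻ x, (H x - τ)) + τ * volume E = (∫⁻ x in E, (H x - τ)) + ∫⁻ _ in E, τ := by
        rw [setLIntegral_const,
          setLIntegral_eq_of_support_subset (s := E) (f := fun x => H x - τ)]
        exact fun x hx => tsub_pos_iff_lt.1 (pos_iff_ne_zero.2 hx)
    _ = ∫⁻ x in E, (H x - τ + τ) := (lintegral_add_right _ measurable_const).symm
    _ = ∫⁻ x in E, H x :=
        setLIntegral_congr_fun hEm fun x hx => tsub_add_cancel_of_le (le_of_lt hx)
    _ ≤ ∫⁻ z in ballRearrange n E, conv2 n (symmRearr n u) (symmRearr n f) z :=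
        setLIntegral_conv2_le_symmRearr hum hfm hEm
    _ ≤ ∫⁻ z in ballRearrange n E, H' z := by
        rw [setLIntegral_conv2 (measurable_symmRearr u) hf' hEm', setLIntegral_conv2 hUm hf' hEm']
        exact (h.symmRearr_left hum).lintegral_mul_le (measurable_symmRearr u) hUm hU
          (measurable_lintegral_mul_add hf' hI) (IsRadiallyDecreasing.lintegral_mul_add hf' hI
            (isRadiallyDecreasing_symmRearr f)
            (isCenteredBall_ballRearrange E).isRadiallyDecreasing_indicator)
    _ ≤ ∫⁻ z in ballRearrange n E, (H' z - τ + τ) := lintegral_mono fun z => le_tsub_add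
    _ = (∫⁻ z in ballRearrange n E, (H' z - τ)) + τ * volume E := by
        rw [lintegral_add_right _ measurable_const, setLIntegral_const, volume_ballRearrange]
    _ ≤ _ := add_le_add_left (setLIntegral_le_lintegral _ _) _

lemma ExcessLE.lintegral_mul_ge {u U φ : EuclideanSpace ℝ (Fin n) → ℝ≥0∞} (h : ExcessLE u U)
    (hum : Measurable u) (hUm : Measurable U) (hU : IsRadiallyDecreasing U)
    (hUu : ∫⁻ x, U x ≤ ∫⁻ x, u x) (hu : ∫⁻ x, u x ≠ ⊤) (hφm : Measurable φ)
    (hφ : ∀ ⦃x y⦄, ‖x‖ ≤ ‖y‖ → φ x ≤ φ y) : ∫⁻ x, U x * φ x ≤ ∫⁻ x, u x * φ x := by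
  simp_rw [mul_comm _ (φ _)]
  rw [lintegral_mul_eq_layer hφm hum, lintegral_mul_eq_layer hφm hUm]
  refine lintegral_mono fun t => ?_
  set D := {x | ENNReal.ofReal t < φ x}
  have hD : MeasurableSet D := measurableSet_lt measurable_const hφm
  have hDc : IsCenteredBall Dᶜ := fun x hx y hy => not_lt.2 ((hφ hy).trans (not_lt.1 hx))
  refine (ENNReal.add_le_add_iff_right
    (ne_top_of_le_ne_top hu (setLIntegral_le_lintegral Dᶜ _))).1 ?_
  calc (∫⁻ x in D, U x) + ∫⁻ x in Dᶜ, u x ≤ (∫⁻ x in D, U x) + ∫⁻ x in Dᶜ, U x :=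
        add_le_add_right (h.setLIntegral_le hU hD.compl hDc) _
    _ ≤ _ := by rwa [lintegral_add_compl _ hD, lintegral_add_compl _ hD]

lemma lintegral_pi_fin_one (f φ : EuclideanSpace ℝ (Fin n) → ℝ≥0∞) :
    ∫⁻ x : Fin 1 → EuclideanSpace ℝ (Fin n), f (x 0) * φ (x 0) = ∫⁻ x, f x * φ x :=
  (volume_preserving_funUnique (Fin 1) (EuclideanSpace ℝ (Fin n))).lintegral_comp_emb
    (MeasurableEquiv.measurableEmbedding _) fun x => f x * φ x

lemma lintegral_pi_fin_succ {k : ℕ} {f : Fin (k + 1) → EuclideanSpace ℝ (Fin n) → ℝ≥0∞}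
    (hf : ∀ i, Measurable (f i)) {w : EuclideanSpace ℝ (Fin n) → ℝ≥0∞} (hwm : Measurable w)
    (hw : ∀ φ, Measurable φ → ∫⁻ x : Fin k → EuclideanSpace ℝ (Fin n),
      (∏ i, f i.succ (x i)) * φ (∑ i, x i) = ∫⁻ x, w x * φ x)
    {φ : EuclideanSpace ℝ (Fin n) → ℝ≥0∞} (hφ : Measurable φ) :
    ∫⁻ x : Fin (k + 1) → EuclideanSpace ℝ (Fin n), (∏ i, f i (x i)) * φ (∑ i, x i) =
      ∫⁻ x, conv2 n w (f 0) x * φ x := by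
  have hm : Measurable fun x : Fin k → EuclideanSpace ℝ (Fin n) => ∏ i, f i.succ (x i) :=
    Finset.measurable_fun_prod _ fun i _ => (hf i.succ).comp (measurable_pi_apply i)
  have hs : Measurable fun x : Fin k → EuclideanSpace ℝ (Fin n) => ∑ i, x i := by fun_prop
  rw [lintegral_conv2_mul hwm (hf 0) hφ, lintegral_mul_lintegral_mul_add_comm hwm (hf 0) hφ]
  have hφy : ∀ y, Measurable fun z => φ (y + z) := fun y => hφ.comp (measurable_const_add y)
  calc _ = ∫⁻ p : EuclideanSpace ℝ (Fin n) × (Fin k → EuclideanSpace ℝ (Fin n)),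
          f 0 p.1 * ((∏ i, f i.succ (p.2 i)) * φ (p.1 + ∑ i, p.2 i)) := by
        rw [← (volume_preserving_piFinSuccAbove (fun _ => EuclideanSpace ℝ (Fin n))
          0).lintegral_comp_emb (MeasurableEquiv.measurableEmbedding _)]
        refine lintegral_congr fun x => ?_
        rw [Fin.prod_univ_succ, Fin.sum_univ_succ, mul_assoc]
        rfl
    _ = ∫⁻ y, ∫⁻ x : Fin k → EuclideanSpace ℝ (Fin n),
          f 0 y * ((∏ i, f i.succ (x i)) * φ (y + ∑ i, x i)) := by
        rw [Measure.volume_eq_prod, lintegral_prod]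
        exact (((hf 0).comp measurable_fst).mul ((hm.comp measurable_snd).mul
          (hφ.comp (measurable_fst.add (hs.comp measurable_snd))))).aemeasurable
    _ = _ := by
        refine lintegral_congr fun y => ?_
        have h : Measurable fun x : Fin k → EuclideanSpace ℝ (Fin n) =>
            (∏ i, f i.succ (x i)) * φ (y + ∑ i, x i) := hm.mul ((hφy y).comp hs)
        rw [lintegral_const_mul _ h, hw _ (hφy y)]

lemma exists_density_sum {k : ℕ} {f : Fin (k + 1) → EuclideanSpace ℝ (Fin n) → ℝ≥0∞}
    (hf : ∀ i, IsDensity n (f i)) :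
    ∃ u U : EuclideanSpace ℝ (Fin n) → ℝ≥0∞, Measurable u ∧ Measurable U ∧
      IsRadiallyDecreasing U ∧ ExcessLE u U ∧ ∫⁻ x, u x = 1 ∧ ∫⁻ x, U x = 1 ∧
      ∀ φ, Measurable φ →
        ∫⁻ x : Fin (k + 1) → EuclideanSpace ℝ (Fin n), (∏ i, f i (x i)) * φ (∑ i, x i) =
          ∫⁻ x, u x * φ x ∧
        ∫⁻ x : Fin (k + 1) → EuclideanSpace ℝ (Fin n),
          (∏ i, symmRearr n (f i) (x i)) * φ (∑ i, x i) = ∫⁻ x, U x * φ x := by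
  have h1 : ∀ i, ∫⁻ x, symmRearr n (f i) x = 1 := fun i =>
    (lintegral_symmRearr (hf i).1).trans (hf i).2
  induction k with
  | zero =>
    refine ⟨f 0, symmRearr n (f 0), (hf 0).1, measurable_symmRearr _,
      isRadiallyDecreasing_symmRearr _, excessLE_symmRearr (hf 0).1, (hf 0).2, h1 0,
      fun φ _ => ?_⟩
    rw [← lintegral_pi_fin_one, ← lintegral_pi_fin_one]
    simp
  | succ k ih =>
    obtain ⟨u, U, hum, hUm, hU, huU, hu1, hU1, h⟩ :=
      ih (f := fun i => f i.succ) (fun i => hf i.succ) fun i => h1 i.succ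
    refine ⟨conv2 n u (f 0), conv2 n U (symmRearr n (f 0)), measurable_conv2 hum (hf 0).1,
      measurable_conv2 hUm (measurable_symmRearr _),
      hU.conv2_isRadiallyDecreasing hUm (measurable_symmRearr _)
        (isRadiallyDecreasing_symmRearr _),
      huU.conv2_symmRearr hum hUm hU (hf 0).1 (by simp [hu1]) (by simp [(hf 0).2]), ?_, ?_,
      fun φ hφ => ⟨?_, ?_⟩⟩
    · rw [lintegral_conv2 hum (hf 0).1, hu1, (hf 0).2, one_mul]
    · rw [lintegral_conv2 hUm (measurable_symmRearr _), hU1, h1 0, one_mul]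
    · exact lintegral_pi_fin_succ (fun i => (hf i).1) hum (fun φ hφ => (h φ hφ).1) hφ
    · exact lintegral_pi_fin_succ (fun i => measurable_symmRearr (f i)) hUm
        (fun φ hφ => (h φ hφ).2) hφ

end Rearrangement
/-- For a nondecreasing `g : [0,∞) → [0,∞)` and independent random vectors
`X₁,…,X_k` with densities `f₁,…,f_k`,
`E[g(‖X₁+⋯+X_k‖)] ≥ E[g(‖X₁*+⋯+X_k*‖)]`, where `Xᵢ*` has density `fᵢ*`. -/
theorem expectation_norm_sum_rearr (n k : ℕ) (g : ℝ → ℝ)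
    (hg : MonotoneOn g (Ici 0)) (hg0 : ∀ x ∈ Ici (0 : ℝ), 0 ≤ g x)
    (f : Fin k → EuclideanSpace ℝ (Fin n) → ℝ≥0∞) (hf : ∀ i, IsDensity n (f i)) :
    ∫⁻ x : Fin k → EuclideanSpace ℝ (Fin n),
        (∏ i, symmRearr n (f i) (x i)) * ENNReal.ofReal (g ‖∑ i, x i‖) ≤
      ∫⁻ x : Fin k → EuclideanSpace ℝ (Fin n),
        (∏ i, f i (x i)) * ENNReal.ofReal (g ‖∑ i, x i‖) := by
  rcases k with _ | k
  · simp
  have hmono : Monotone fun r : ℝ => ENNReal.ofReal (g (max r 0)) := fun r s h =>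
    ENNReal.ofReal_le_ofReal (hg (le_max_right r 0) (le_max_right s 0) (max_le_max_right _ h))
  have hφ : (fun x : EuclideanSpace ℝ (Fin n) => ENNReal.ofReal (g ‖x‖)) =
      fun x => ENNReal.ofReal (g (max ‖x‖ 0)) := by
    simp
  have hφm : Measurable fun x : EuclideanSpace ℝ (Fin n) => ENNReal.ofReal (g ‖x‖) := by
    rw [hφ]
    exact hmono.measurable.comp measurable_norm
  obtain ⟨u, U, hum, hUm, hU, huU, hu1, hU1, h⟩ := exists_density_sum hf
  obtain ⟨h1, h2⟩ := h _ hφm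
  rw [h1, h2]
  exact huU.lintegral_mul_ge hum hUm hU (hU1.trans hu1.symm).le (by simp [hu1]) hφm fun x y hxy =>
    ENNReal.ofReal_le_ofReal (hg (norm_nonneg x) (norm_nonneg y) hxy)
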